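/- Lemma 1: An R-expression Δ ⇒ S is derivable in the calculus SC∞ (extended with connectives defined by the generalized rule schemata (I)–(IV)) if and only if the sequent Δ* ⇒ S* is derivable in the sequent calculus G3C for the connexive logic C, where * is the translation eliminating defined connectives and higher-order structure in favour of formulas over {∼, ∧, ∨, →}. -/

import Mathlib

/-- Pure formulas of the connexive logic `C`, over `{∼, ∧, ∨, →}`. -/
inductive PFormula : Type
  | var : ℕ → PFormula
  | snot : PFormula → PFormula
  | and : PFormula → PFormula → PFormula
  | or : PFormula → PFormula → PFormula
  | imp : PFormula → PFormula → PFormula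

/-- Formulas built by `∼, ∧, ∨, →` and finitely many additional connectives
from `K` (with arities `ar`). -/
inductive GFormula (K : Type) (ar : K → ℕ) : Type
  | var : ℕ → GFormula K ar
  | snot : GFormula K ar → GFormula K ar
  | and : GFormula K ar → GFormula K ar → GFormula K ar
  | or : GFormula K ar → GFormula K ar → GFormula K ar
  | imp : GFormula K ar → GFormula K ar → GFormula K ar
  | app : (k : K) → (Fin (ar k) → GFormula K ar) → GFormula K ar

/-- R-expressions over a type `Φ` of formulas. -/
inductive RExprOf (Φ : Type) : Type
  | fm : Φ → RExprOf Φ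
  | negFm : Φ → RExprOf Φ
  | seq : List (RExprOf Φ) → RExprOf Φ → RExprOf Φ
  | negSeq : List (RExprOf Φ) → RExprOf Φ → RExprOf Φ

/-- The refutation `−S` of an R-expression, with `−−S = S`. -/
def rnegOf {Φ : Type} : RExprOf Φ → RExprOf Φ
  | .fm A => .negFm A
  | .negFm A => .fm A
  | .seq Δ S => .negSeq Δ S
  | .negSeq Δ S => .seq Δ S

/-- Schematic R-expressions whose formula components are among the
placeholders `A₁, …, Aₘ` (represented by `Fin m`). -/
inductive SRExpr (m : ℕ) : Type
  | fm : Fin m → SRExpr m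
  | negFm : Fin m → SRExpr m
  | seq : List (SRExpr m) → SRExpr m → SRExpr m
  | negSeq : List (SRExpr m) → SRExpr m → SRExpr m

mutual
/-- Instantiation of a schematic R-expression at arguments `A₁, …, Aₘ`. -/
def instOf {Φ : Type} {m : ℕ} (σ : Fin m → Φ) : SRExpr m → RExprOf Φ
  | .fm i => .fm (σ i)
  | .negFm i => .negFm (σ i)
  | .seq Δ S => .seq (instListOf σ Δ) (instOf σ S)
  | .negSeq Δ S => .negSeq (instListOf σ Δ) (instOf σ S)

def instListOf {Φ : Type} {m : ℕ} (σ : Fin m → Φ) : List (SRExpr m) → List (RExprOf Φ)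
  | [] => []
  | S :: Δ => instOf σ S :: instListOf σ Δ
end

mutual
/-- The formula translation `S̄` of an R-expression, relative to the
negation `sn`, conjunction `an` and implication `im` of the formula type. -/
def barOf {Φ : Type} (sn : Φ → Φ) (an : Φ → Φ → Φ) (im : Φ → Φ → Φ) : RExprOf Φ → Φ
  | .fm A => A
  | .negFm A => sn A
  | .seq [] S => barOf sn an im S
  | .seq (U :: Γ) S =>
      im ((barListOf sn an im Γ).foldl an (barOf sn an im U)) (barOf sn an im S)
  | .negSeq [] S => sn (barOf sn an im S)
  | .negSeq (U :: Γ) S =>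
      sn (im ((barListOf sn an im Γ).foldl an (barOf sn an im U)) (barOf sn an im S))

def barListOf {Φ : Type} (sn : Φ → Φ) (an : Φ → Φ → Φ) (im : Φ → Φ → Φ) :
    List (RExprOf Φ) → List Φ
  | [] => []
  | S :: Δ => barOf sn an im S :: barListOf sn an im Δ
end

/-- Conjunction (resp. disjunction) of a nonempty list (junk value on `[]`). -/
def foldOfList {Φ : Type} (junk : Φ) (op : Φ → Φ → Φ) : List Φ → Φ
  | [] => junk
  | A :: l => l.foldl op A

/-- Defining data for an `m`-ary connective: a doubly indexed family of
schematic R-expressions `S_{i k}` (`i = 1,…,t`; `k = 1,…,s_i`). -/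
structure ConnDef (m : ℕ) : Type where
  t : ℕ
  s : Fin t → ℕ
  S : (i : Fin t) → Fin (s i) → SRExpr m

/-- `S̄` for R-expressions over pure formulas. -/
def barP : RExprOf PFormula → PFormula :=
  barOf .snot .and .imp

/-- The defining pure formula
`(S̄₁₁ ∧ … ∧ S̄₁s₁) ∨ … ∨ (S̄_t1 ∧ … ∧ S̄_tsₜ)` of a defined connective at pure
arguments `τ`. -/
def defFormulaP {m : ℕ} (C : ConnDef m) (τ : Fin m → PFormula) : PFormula :=
  foldOfList (.var 0) .or (List.ofFn fun i : Fin C.t =>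
    foldOfList (.var 0) .and (List.ofFn fun k : Fin (C.s i) => barP (instOf τ (C.S i k))))

/-- The translation `*` eliminating the defined connectives: `p* = p`,
`*` commutes with `∼, ∧, ∨, →`, and `(F(A₁,…,Aₙ))*` is obtained from the
defining formula of `F` by simultaneously replacing each `Aᵢ` by `Aᵢ*`. -/
def star {K : Type} {ar : K → ℕ} (D : (k : K) → ConnDef (ar k)) :
    GFormula K ar → PFormula
  | .var n => .var n
  | .snot A => .snot (star D A)
  | .and A B => .and (star D A) (star D B)
  | .or A B => .or (star D A) (star D B)
  | .imp A B => .imp (star D A) (star D B)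
  | .app k σ => defFormulaP (D k) (fun i => star D (σ i))

/-- `S̄` for R-expressions over the extended language. -/
def barG {K : Type} {ar : K → ℕ} : RExprOf (GFormula K ar) → GFormula K ar :=
  barOf .snot .and .imp

/-- `S* = (S̄)*` for R-expressions over the extended language. -/
def starR {K : Type} {ar : K → ℕ} (D : (k : K) → ConnDef (ar k))
    (S : RExprOf (GFormula K ar)) : PFormula :=
  star D (barG S)

/-- Derivability in `SC∞` over the extended language, with the connectives
from `K` governed by the generalized rule schemata (I)–(IV) given by `D`,
from the premise set `P`. -/
inductive SCG {K : Type} {ar : K → ℕ} (D : (k : K) → ConnDef (ar k))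
    (P : Set (RExprOf (GFormula K ar))) : RExprOf (GFormula K ar) → Prop
  | prem {S} : S ∈ P → SCG D P S
  | rf (S) : SCG D P (.seq [S] S)
  | wl {Δ S} (T) : SCG D P (.seq Δ S) → SCG D P (.seq (Δ ++ [T]) S)
  | pl {U} (Δ S T Γ) : SCG D P (.seq (Δ ++ S :: T :: Γ) U) →
      SCG D P (.seq (Δ ++ T :: S :: Γ) U)
  | cl {Δ S T} : SCG D P (.seq (Δ ++ [S, S]) T) → SCG D P (.seq (Δ ++ [S]) T)
  | cut {Δ S T} : SCG D P (.seq Δ S) → SCG D P (.seq (Δ ++ [S]) T) → SCG D P (.seq Δ T)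
  | riP {Γ Δ S} : SCG D P (.seq (Γ ++ Δ) S) → SCG D P (.seq Γ (.seq Δ S))
  | liP {Γ Δ S T} : (∀ U ∈ Δ, SCG D P (.seq Γ U)) → SCG D P (.seq (Γ ++ [S]) T) →
      SCG D P (.seq (Γ ++ [.seq Δ S]) T)
  | riN {Δ Γ S} : SCG D P (.seq (Δ ++ Γ) (rnegOf S)) → SCG D P (.seq Δ (rnegOf (.seq Γ S)))
  | riN' {Δ Γ S} : SCG D P (.seq Δ (rnegOf (.seq Γ S))) → SCG D P (.seq (Δ ++ Γ) (rnegOf S))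
  | liN {Δ Γ S T} : (∀ U ∈ Γ, SCG D P (.seq Δ U)) → SCG D P (.seq (Δ ++ [rnegOf S]) T) →
      SCG D P (.seq (Δ ++ [rnegOf (.seq Γ S)]) T)
  | snotL {Δ A S} : SCG D P (.seq (Δ ++ [.negFm A]) S) → SCG D P (.seq (Δ ++ [.fm (.snot A)]) S)
  | snotR {Δ A} : SCG D P (.seq Δ (.negFm A)) → SCG D P (.seq Δ (.fm (.snot A)))
  | snotLm {Δ A S} : SCG D P (.seq (Δ ++ [.fm A]) S) → SCG D P (.seq (Δ ++ [.negFm (.snot A)]) S)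
  | snotRm {Δ A} : SCG D P (.seq Δ (.fm A)) → SCG D P (.seq Δ (.negFm (.snot A)))
  | andL {Δ A B S} : SCG D P (.seq (Δ ++ [.fm A, .fm B]) S) →
      SCG D P (.seq (Δ ++ [.fm (.and A B)]) S)
  | andR {Δ A B} : SCG D P (.seq Δ (.fm A)) → SCG D P (.seq Δ (.fm B)) →
      SCG D P (.seq Δ (.fm (.and A B)))
  | andLm {Δ A B S} : SCG D P (.seq (Δ ++ [.negFm A]) S) → SCG D P (.seq (Δ ++ [.negFm B]) S) →
      SCG D P (.seq (Δ ++ [.negFm (.and A B)]) S)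
  | andRm₁ {Δ A B} : SCG D P (.seq Δ (.negFm A)) → SCG D P (.seq Δ (.negFm (.and A B)))
  | andRm₂ {Δ A B} : SCG D P (.seq Δ (.negFm B)) → SCG D P (.seq Δ (.negFm (.and A B)))
  | orL {Δ A B S} : SCG D P (.seq (Δ ++ [.fm A]) S) → SCG D P (.seq (Δ ++ [.fm B]) S) →
      SCG D P (.seq (Δ ++ [.fm (.or A B)]) S)
  | orR₁ {Δ A B} : SCG D P (.seq Δ (.fm A)) → SCG D P (.seq Δ (.fm (.or A B)))
  | orR₂ {Δ A B} : SCG D P (.seq Δ (.fm B)) → SCG D P (.seq Δ (.fm (.or A B)))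
  | orLm {Δ A B S} : SCG D P (.seq (Δ ++ [.negFm A, .negFm B]) S) →
      SCG D P (.seq (Δ ++ [.negFm (.or A B)]) S)
  | orRm {Δ A B} : SCG D P (.seq Δ (.negFm A)) → SCG D P (.seq Δ (.negFm B)) →
      SCG D P (.seq Δ (.negFm (.or A B)))
  | impL {Δ A B S} : SCG D P (.seq (Δ ++ [.seq [.fm A] (.fm B)]) S) →
      SCG D P (.seq (Δ ++ [.fm (.imp A B)]) S)
  | impR {Δ A B} : SCG D P (.seq Δ (.seq [.fm A] (.fm B))) → SCG D P (.seq Δ (.fm (.imp A B)))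
  | impLm {Δ A B S} : SCG D P (.seq (Δ ++ [.negSeq [.fm A] (.fm B)]) S) →
      SCG D P (.seq (Δ ++ [.negFm (.imp A B)]) S)
  | impRm {Δ A B} : SCG D P (.seq Δ (.negSeq [.fm A] (.fm B))) →
      SCG D P (.seq Δ (.negFm (.imp A B)))
  -- schema (I)
  | schemaI {Δ} {k : K} {σ : Fin (ar k) → GFormula K ar} (i : Fin (D k).t) :
      (∀ j : Fin ((D k).s i), SCG D P (.seq Δ (instOf σ ((D k).S i j)))) →
      SCG D P (.seq Δ (.fm (.app k σ)))
  -- schema (II)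
  | schemaII {Δ T} {k : K} {σ : Fin (ar k) → GFormula K ar} :
      (∀ i : Fin (D k).t,
        SCG D P (.seq (Δ ++ List.ofFn (fun j => instOf σ ((D k).S i j))) T)) →
      SCG D P (.seq (Δ ++ [.fm (.app k σ)]) T)
  -- schema (III)
  | schemaIII {Δ} {k : K} {σ : Fin (ar k) → GFormula K ar}
      (c : (i : Fin (D k).t) → Fin ((D k).s i)) :
      (∀ i : Fin (D k).t, SCG D P (.seq Δ (rnegOf (instOf σ ((D k).S i (c i)))))) →
      SCG D P (.seq Δ (.negFm (.app k σ)))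
  -- schema (IV)
  | schemaIV {Δ T} {k : K} {σ : Fin (ar k) → GFormula K ar} :
      (∀ c : (i : Fin (D k).t) → Fin ((D k).s i),
        SCG D P (.seq (Δ ++ List.ofFn (fun i => rnegOf (instOf σ ((D k).S i (c i))))) T)) →
      SCG D P (.seq (Δ ++ [.negFm (.app k σ)]) T)

/-- Derivability of sequents `Γ ⇒ A` (with `Γ` a finite multiset of pure
formulas) in the sequent calculus `G3C` for the connexive logic `C`. -/
inductive Gder : Multiset PFormula → PFormula → Prop
  | ax {Γ n} : Gder (.var n ::ₘ Γ) (.var n)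
  | axSnot {Γ n} : Gder (.snot (.var n) ::ₘ Γ) (.snot (.var n))
  | andR {Γ A B} : Gder Γ A → Gder Γ B → Gder Γ (.and A B)
  | andL {Γ A B C} : Gder (A ::ₘ B ::ₘ Γ) C → Gder (.and A B ::ₘ Γ) C
  | orR₁ {Γ A B} : Gder Γ A → Gder Γ (.or A B)
  | orR₂ {Γ A B} : Gder Γ B → Gder Γ (.or A B)
  | orL {Γ A B C} : Gder (A ::ₘ Γ) C → Gder (B ::ₘ Γ) C → Gder (.or A B ::ₘ Γ) C
  | impR {Γ A B} : Gder (A ::ₘ Γ) B → Gder Γ (.imp A B)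
  | impL {Γ A B C} : Gder (.imp A B ::ₘ Γ) A → Gder (B ::ₘ Γ) C → Gder (.imp A B ::ₘ Γ) C
  | snotSnotR {Γ A} : Gder Γ A → Gder Γ (.snot (.snot A))
  | snotSnotL {Γ A C} : Gder (A ::ₘ Γ) C → Gder (.snot (.snot A) ::ₘ Γ) C
  | snotAndR₁ {Γ A B} : Gder Γ (.snot A) → Gder Γ (.snot (.and A B))
  | snotAndR₂ {Γ A B} : Gder Γ (.snot B) → Gder Γ (.snot (.and A B))
  | snotAndL {Γ A B C} : Gder (.snot A ::ₘ Γ) C → Gder (.snot B ::ₘ Γ) C →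
      Gder (.snot (.and A B) ::ₘ Γ) C
  | snotOrR {Γ A B} : Gder Γ (.snot A) → Gder Γ (.snot B) → Gder Γ (.snot (.or A B))
  | snotOrL {Γ A B C} : Gder (.snot A ::ₘ .snot B ::ₘ Γ) C → Gder (.snot (.or A B) ::ₘ Γ) C
  | snotImpR {Γ A B} : Gder (A ::ₘ Γ) (.snot B) → Gder Γ (.snot (.imp A B))
  | snotImpL {Γ A B C} : Gder (.snot (.imp A B) ::ₘ Γ) A → Gder (.snot B ::ₘ Γ) C →
      Gder (.snot (.imp A B) ::ₘ Γ) C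

/-! ### The positive calculus -/

/-- Positive formulas over signed atoms. -/
inductive Pos : Type
  | atm : Bool → ℕ → Pos
  | and : Pos → Pos → Pos
  | or : Pos → Pos → Pos
  | imp : Pos → Pos → Pos

inductive PD : Multiset Pos → Pos → Prop
  | ax {Γ b n} : PD (.atm b n ::ₘ Γ) (.atm b n)
  | andR {Γ A B} : PD Γ A → PD Γ B → PD Γ (.and A B)
  | andL {Γ A B C} : PD (A ::ₘ B ::ₘ Γ) C → PD (.and A B ::ₘ Γ) C
  | orR₁ {Γ A B} : PD Γ A → PD Γ (.or A B)
  | orR₂ {Γ A B} : PD Γ B → PD Γ (.or A B)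
  | orL {Γ A B C} : PD (A ::ₘ Γ) C → PD (B ::ₘ Γ) C → PD (.or A B ::ₘ Γ) C
  | impR {Γ A B} : PD (A ::ₘ Γ) B → PD Γ (.imp A B)
  | impL {Γ A B C} : PD (.imp A B ::ₘ Γ) A → PD (B ::ₘ Γ) C → PD (.imp A B ::ₘ Γ) C

theorem PD.cast {Γ Γ' : Multiset Pos} {C : Pos} (h : PD Γ C) (e : Γ = Γ') : PD Γ' C := e ▸ h

theorem PD.weak {Γ : Multiset Pos} {C : Pos} (h : PD Γ C) (M : Multiset Pos) : PD (M + Γ) C := by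
  induction h with
  | ax => rw [Multiset.add_cons]; exact .ax
  | andR _ _ h1 h2 => exact .andR h1 h2
  | andL _ h1 => rw [Multiset.add_cons]; exact .andL (by simpa only [Multiset.add_cons] using h1)
  | orR₁ _ h1 => exact .orR₁ h1
  | orR₂ _ h1 => exact .orR₂ h1
  | orL _ _ h1 h2 =>
    simp only [Multiset.add_cons] at *; exact .orL h1 h2
  | impR _ h1 => simp only [Multiset.add_cons] at *; exact .impR h1
  | impL _ _ h1 h2 => simp only [Multiset.add_cons] at *; exact .impL h1 h2

inductive InvRel : Pos → Multiset Pos → Prop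
  | and (X Y) : InvRel (.and X Y) (X ::ₘ Y ::ₘ 0)
  | or₁ (X Y) : InvRel (.or X Y) (X ::ₘ 0)
  | or₂ (X Y) : InvRel (.or X Y) (Y ::ₘ 0)
  | imp (X Y) : InvRel (.imp X Y) (Y ::ₘ 0)

theorem PD.inv {A : Pos} {M : Multiset Pos} (hA : InvRel A M) {Θ : Multiset Pos} {C : Pos}
    (h : PD Θ C) : ∀ Γ, Θ = A ::ₘ Γ → PD (M + Γ) C := by
  induction h with
  | ax =>
    intro Γ e
    rcases Multiset.cons_eq_cons.1 e with ⟨e1, -⟩ | ⟨-, Γ', rfl, rfl⟩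
    · subst e1; cases hA
    · rw [Multiset.add_cons]; exact .ax
  | andR _ _ h1 h2 => intro Γ e; exact .andR (h1 Γ e) (h2 Γ e)
  | @andL Γ0 A0 B0 C0 h h1 =>
    intro Γ e
    rcases Multiset.cons_eq_cons.1 e with ⟨e1, e2⟩ | ⟨-, Γ', rfl, rfl⟩
    · subst e1 e2; cases hA; simpa using h
    · have := h1 (A0 ::ₘ B0 ::ₘ Γ') (by simp only [← Multiset.singleton_add]; abel)
      simp only [Multiset.add_cons] at *
      exact .andL this
  | orR₁ _ h1 => intro Γ e; exact .orR₁ (h1 Γ e)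
  | orR₂ _ h1 => intro Γ e; exact .orR₂ (h1 Γ e)
  | @orL Γ0 A0 B0 C0 h h' h1 h2 =>
    intro Γ e
    rcases Multiset.cons_eq_cons.1 e with ⟨e1, e2⟩ | ⟨-, Γ', rfl, rfl⟩
    · subst e1 e2; cases hA
      · simpa using h
      · simpa using h'
    · have a1 := h1 (A0 ::ₘ Γ') (Multiset.cons_swap _ _ _)
      have a2 := h2 (B0 ::ₘ Γ') (Multiset.cons_swap _ _ _)
      simp only [Multiset.add_cons] at *
      exact .orL a1 a2
  | @impR Γ0 A0 B0 h h1 =>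
    intro Γ e
    have a1 := h1 (A0 ::ₘ Γ) (by rw [e, Multiset.cons_swap])
    simp only [Multiset.add_cons] at *
    exact .impR a1
  | @impL Γ0 A0 B0 C0 h h' h1 h2 =>
    intro Γ e
    rcases Multiset.cons_eq_cons.1 e with ⟨e1, e2⟩ | ⟨-, Γ', rfl, rfl⟩
    · subst e1 e2; cases hA
      simpa using h'
    · have a1 := h1 (A0.imp B0 ::ₘ Γ') (Multiset.cons_swap _ _ _)
      have a2 := h2 (B0 ::ₘ Γ') (Multiset.cons_swap _ _ _)
      simp only [Multiset.add_cons] at *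
      exact .impL a1 a2

theorem PD.weak1 {Γ : Multiset Pos} {C : Pos} (h : PD Γ C) (A : Pos) : PD (A ::ₘ Γ) C := by
  simpa using h.weak {A}

theorem PD.invAnd {Γ : Multiset Pos} {X Y C : Pos} (h : PD (.and X Y ::ₘ Γ) C) :
    PD (X ::ₘ Y ::ₘ Γ) C := by simpa using h.inv (.and X Y) _ rfl
theorem PD.invOr₁ {Γ : Multiset Pos} {X Y C : Pos} (h : PD (.or X Y ::ₘ Γ) C) :
    PD (X ::ₘ Γ) C := by simpa using h.inv (.or₁ X Y) _ rfl
theorem PD.invOr₂ {Γ : Multiset Pos} {X Y C : Pos} (h : PD (.or X Y ::ₘ Γ) C) :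
    PD (Y ::ₘ Γ) C := by simpa using h.inv (.or₂ X Y) _ rfl
theorem PD.invImp {Γ : Multiset Pos} {X Y C : Pos} (h : PD (.imp X Y ::ₘ Γ) C) :
    PD (Y ::ₘ Γ) C := by simpa using h.inv (.imp X Y) _ rfl

theorem PD.invAndR {Γ : Multiset Pos} {X Y C : Pos} (h : PD Γ C) (e : C = .and X Y) :
    PD Γ X ∧ PD Γ Y := by
  induction h with
  | ax => cases e
  | andR h1 h2 => cases e; exact ⟨h1, h2⟩
  | andL _ h1 => exact ⟨.andL (h1 e).1, .andL (h1 e).2⟩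
  | orR₁ => cases e
  | orR₂ => cases e
  | orL _ _ h1 h2 => exact ⟨.orL (h1 e).1 (h2 e).1, .orL (h1 e).2 (h2 e).2⟩
  | impR => cases e
  | impL h _ _ h2 => exact ⟨.impL h (h2 e).1, .impL h (h2 e).2⟩

theorem PD.invImpR {Γ : Multiset Pos} {X Y C : Pos} (h : PD Γ C) (e : C = .imp X Y) :
    PD (X ::ₘ Γ) Y := by
  induction h with
  | ax => cases e
  | andR h1 h2 => cases e
  | andL _ h1 =>
    rw [Multiset.cons_swap]
    exact .andL ((h1 e).cast (by simp only [← Multiset.singleton_add]; abel))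
  | orR₁ => cases e
  | orR₂ => cases e
  | orL _ _ h1 h2 =>
    rw [Multiset.cons_swap]
    exact .orL ((h1 e).cast (Multiset.cons_swap _ _ _)) ((h2 e).cast (Multiset.cons_swap _ _ _))
  | impR h => cases e; exact h
  | impL h _ _ h2 =>
    rw [Multiset.cons_swap]
    exact .impL ((h.weak1 X).cast (Multiset.cons_swap _ _ _))
      ((h2 e).cast (Multiset.cons_swap _ _ _))

/-- contraction of an atom -/
theorem PD.contrAt {b : Bool} {n : ℕ} {Θ : Multiset Pos} {C : Pos} (h : PD Θ C) :
    ∀ Γ, Θ = .atm b n ::ₘ .atm b n ::ₘ Γ → PD (.atm b n ::ₘ Γ) C := by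
  induction h with
  | @ax Γ0 b0 n0 =>
    intro Γ e
    have : Pos.atm b0 n0 ∈ Pos.atm b n ::ₘ Γ := by
      have : Pos.atm b0 n0 ∈ Pos.atm b n ::ₘ Pos.atm b n ::ₘ Γ := by rw [← e]; simp
      simpa using this
    obtain ⟨t, ht⟩ := Multiset.exists_cons_of_mem this
    rw [ht]; exact .ax
  | andR _ _ h1 h2 => intro Γ e; exact .andR (h1 Γ e) (h2 Γ e)
  | @andL Γ0 A0 B0 C0 h h1 =>
    intro Γ e
    rcases Multiset.cons_eq_cons.1 e with ⟨e1, e2⟩ | ⟨-, Γ', rfl, e2⟩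
    · cases e1
    rcases Multiset.cons_eq_cons.1 e2 with ⟨e1, e2⟩ | ⟨-, Γ'', rfl, rfl⟩
    · cases e1
    rw [Multiset.cons_swap]
    exact .andL ((h1 (A0 ::ₘ B0 ::ₘ Γ'') (by simp only [← Multiset.singleton_add]; abel)).cast
      (by simp only [← Multiset.singleton_add]; abel))
  | orR₁ _ h1 => intro Γ e; exact .orR₁ (h1 Γ e)
  | orR₂ _ h1 => intro Γ e; exact .orR₂ (h1 Γ e)
  | @orL Γ0 A0 B0 C0 h h' h1 h2 =>
    intro Γ e
    rcases Multiset.cons_eq_cons.1 e with ⟨e1, e2⟩ | ⟨-, Γ', rfl, e2⟩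
    · cases e1
    rcases Multiset.cons_eq_cons.1 e2 with ⟨e1, e2⟩ | ⟨-, Γ'', rfl, rfl⟩
    · cases e1
    rw [Multiset.cons_swap]
    exact .orL ((h1 (A0 ::ₘ Γ'') (by simp only [← Multiset.singleton_add]; abel)).cast
      (Multiset.cons_swap _ _ _)) ((h2 (B0 ::ₘ Γ'')
        (by simp only [← Multiset.singleton_add]; abel)).cast (Multiset.cons_swap _ _ _))
  | @impR Γ0 A0 B0 h h1 =>
    intro Γ e
    subst e
    exact .impR ((h1 (A0 ::ₘ Γ) (by simp only [← Multiset.singleton_add]; abel)).cast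
      (Multiset.cons_swap _ _ _))
  | @impL Γ0 A0 B0 C0 h h' h1 h2 =>
    intro Γ e
    rcases Multiset.cons_eq_cons.1 e with ⟨e1, e2⟩ | ⟨-, Γ', rfl, e2⟩
    · cases e1
    rcases Multiset.cons_eq_cons.1 e2 with ⟨e1, e2⟩ | ⟨-, Γ'', rfl, rfl⟩
    · cases e1
    rw [Multiset.cons_swap]
    exact .impL ((h1 (A0.imp B0 ::ₘ Γ'') (by simp only [← Multiset.singleton_add]; abel)).cast
      (Multiset.cons_swap _ _ _)) ((h2 (B0 ::ₘ Γ'')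
        (by simp only [← Multiset.singleton_add]; abel)).cast (Multiset.cons_swap _ _ _))

/-- contraction of an implication -/
theorem PD.contrImp {X Y : Pos} (hY : ∀ Γ C, PD (Y ::ₘ Y ::ₘ Γ) C → PD (Y ::ₘ Γ) C)
    {Θ : Multiset Pos} {C : Pos} (h : PD Θ C) :
    ∀ Γ, Θ = .imp X Y ::ₘ .imp X Y ::ₘ Γ → PD (.imp X Y ::ₘ Γ) C := by
  induction h with
  | @ax Γ0 b0 n0 =>
    intro Γ e
    have : Pos.atm b0 n0 ∈ Pos.imp X Y ::ₘ Γ := by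
      have : Pos.atm b0 n0 ∈ Pos.imp X Y ::ₘ Pos.imp X Y ::ₘ Γ := by rw [← e]; simp
      simpa using this
    obtain ⟨t, ht⟩ := Multiset.exists_cons_of_mem this
    rw [ht]; exact .ax
  | andR _ _ h1 h2 => intro Γ e; exact .andR (h1 Γ e) (h2 Γ e)
  | @andL Γ0 A0 B0 C0 h h1 =>
    intro Γ e
    rcases Multiset.cons_eq_cons.1 e with ⟨e1, e2⟩ | ⟨-, Γ', rfl, e2⟩
    · cases e1
    rcases Multiset.cons_eq_cons.1 e2 with ⟨e1, e2⟩ | ⟨-, Γ'', rfl, rfl⟩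
    · cases e1
    rw [Multiset.cons_swap]
    exact .andL ((h1 (A0 ::ₘ B0 ::ₘ Γ'') (by simp only [← Multiset.singleton_add]; abel)).cast
      (by simp only [← Multiset.singleton_add]; abel))
  | orR₁ _ h1 => intro Γ e; exact .orR₁ (h1 Γ e)
  | orR₂ _ h1 => intro Γ e; exact .orR₂ (h1 Γ e)
  | @orL Γ0 A0 B0 C0 h h' h1 h2 =>
    intro Γ e
    rcases Multiset.cons_eq_cons.1 e with ⟨e1, e2⟩ | ⟨-, Γ', rfl, e2⟩
    · cases e1
    rcases Multiset.cons_eq_cons.1 e2 with ⟨e1, e2⟩ | ⟨-, Γ'', rfl, rfl⟩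
    · cases e1
    rw [Multiset.cons_swap]
    exact .orL ((h1 (A0 ::ₘ Γ'') (by simp only [← Multiset.singleton_add]; abel)).cast
      (Multiset.cons_swap _ _ _)) ((h2 (B0 ::ₘ Γ'')
        (by simp only [← Multiset.singleton_add]; abel)).cast (Multiset.cons_swap _ _ _))
  | @impR Γ0 A0 B0 h h1 =>
    intro Γ e
    subst e
    exact .impR ((h1 (A0 ::ₘ Γ) (by simp only [← Multiset.singleton_add]; abel)).cast
      (Multiset.cons_swap _ _ _))
  | @impL Γ0 A0 B0 C0 h h' h1 h2 =>
    intro Γ e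
    rcases Multiset.cons_eq_cons.1 e with ⟨e1, e2⟩ | ⟨hne, Γ', rfl, e2⟩
    · cases e1
      subst e2
      exact .impL (h1 Γ rfl) (hY _ _ (PD.invImp (h'.cast (Multiset.cons_swap _ _ _))))
    rcases Multiset.cons_eq_cons.1 e2 with ⟨e1, e2⟩ | ⟨-, Γ'', rfl, rfl⟩
    · exact absurd e1.symm hne
    rw [Multiset.cons_swap]
    exact .impL ((h1 (A0.imp B0 ::ₘ Γ'') (by simp only [← Multiset.singleton_add]; abel)).cast
      (Multiset.cons_swap _ _ _)) ((h2 (B0 ::ₘ Γ'')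
        (by simp only [← Multiset.singleton_add]; abel)).cast (Multiset.cons_swap _ _ _))

theorem PD.contr (A : Pos) : ∀ Γ C, PD (A ::ₘ A ::ₘ Γ) C → PD (A ::ₘ Γ) C := by
  induction A with
  | atm b n => intro Γ C h; exact h.contrAt Γ rfl
  | and X Y hX hY =>
    intro Γ C h
    have h1 : PD (X ::ₘ X ::ₘ Y ::ₘ Y ::ₘ Γ) C :=
      (PD.invAnd (Γ := X ::ₘ Y ::ₘ Γ) (h.invAnd.cast
        (by simp only [← Multiset.singleton_add]; abel))).cast
        (by simp only [← Multiset.singleton_add]; abel)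
    have h2 := hX _ _ h1
    have h3 := hY (X ::ₘ Γ) _ (h2.cast (by simp only [← Multiset.singleton_add]; abel))
    exact .andL (h3.cast (Multiset.cons_swap _ _ _))
  | or X Y hX hY =>
    intro Γ C h
    exact .orL (hX _ _ (PD.invOr₁ (h.invOr₁.cast (Multiset.cons_swap _ _ _))))
      (hY _ _ (PD.invOr₂ (h.invOr₂.cast (Multiset.cons_swap _ _ _))))
  | imp X Y hX hY => intro Γ C h; exact h.contrImp hY Γ rfl

theorem PD.cutAt {b : Bool} {n : ℕ} {Γ : Multiset Pos} {A : Pos} (h : PD Γ A) :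
    A = .atm b n → ∀ C, PD (.atm b n ::ₘ Γ) C → PD Γ C := by
  induction h with
  | ax => intro e C h; cases e; exact PD.contr _ _ _ h
  | andR => intro e; cases e
  | andL _ h1 =>
    intro e C h
    exact .andL (h1 e C ((h.cast (Multiset.cons_swap _ _ _)).invAnd.cast
      (by simp only [← Multiset.singleton_add]; abel)))
  | orR₁ => intro e; cases e
  | orR₂ => intro e; cases e
  | orL _ _ h1 h2 =>
    intro e C h
    have h' := h.cast (Multiset.cons_swap _ _ _)
    exact .orL (h1 e C (h'.invOr₁.cast (Multiset.cons_swap _ _ _)))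
      (h2 e C (h'.invOr₂.cast (Multiset.cons_swap _ _ _)))
  | impR => intro e; cases e
  | impL h0 _ _ h2 =>
    intro e C h
    have h' := h.cast (Multiset.cons_swap _ _ _)
    exact .impL h0 (h2 e C (h'.invImp.cast (Multiset.cons_swap _ _ _)))

theorem PD.cutOr {X Y : Pos} (hX : ∀ Γ C, PD Γ X → PD (X ::ₘ Γ) C → PD Γ C)
    (hY : ∀ Γ C, PD Γ Y → PD (Y ::ₘ Γ) C → PD Γ C) {Γ : Multiset Pos} {A : Pos} (h : PD Γ A) :
    A = .or X Y → ∀ C, PD (.or X Y ::ₘ Γ) C → PD Γ C := by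
  induction h with
  | ax => intro e; cases e
  | andR => intro e; cases e
  | andL _ h1 =>
    intro e C h
    exact .andL (h1 e C ((h.cast (Multiset.cons_swap _ _ _)).invAnd.cast
      (by simp only [← Multiset.singleton_add]; abel)))
  | orR₁ h => intro e C h'; cases e; exact hX _ _ h h'.invOr₁
  | orR₂ h => intro e C h'; cases e; exact hY _ _ h h'.invOr₂
  | orL _ _ h1 h2 =>
    intro e C h
    have h' := h.cast (Multiset.cons_swap _ _ _)
    exact .orL (h1 e C (h'.invOr₁.cast (Multiset.cons_swap _ _ _)))
      (h2 e C (h'.invOr₂.cast (Multiset.cons_swap _ _ _)))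
  | impR => intro e; cases e
  | impL h0 _ _ h2 =>
    intro e C h
    have h' := h.cast (Multiset.cons_swap _ _ _)
    exact .impL h0 (h2 e C (h'.invImp.cast (Multiset.cons_swap _ _ _)))

theorem PD.cutImp {X Y : Pos} (hX : ∀ Γ C, PD Γ X → PD (X ::ₘ Γ) C → PD Γ C)
    (hY : ∀ Γ C, PD Γ Y → PD (Y ::ₘ Γ) C → PD Γ C) {Θ : Multiset Pos} {C : Pos} (h : PD Θ C) :
    ∀ Γ, Θ = .imp X Y ::ₘ Γ → PD (X ::ₘ Γ) Y → PD Γ C := by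
  induction h with
  | ax =>
    intro Γ e _
    rcases Multiset.cons_eq_cons.1 e with ⟨e1, -⟩ | ⟨-, Γ', rfl, rfl⟩
    · cases e1
    · exact .ax
  | andR _ _ h1 h2 => intro Γ e h; exact .andR (h1 Γ e h) (h2 Γ e h)
  | @andL Γ0 A0 B0 C0 h h1 =>
    intro Γ e hc
    rcases Multiset.cons_eq_cons.1 e with ⟨e1, e2⟩ | ⟨-, Γ', rfl, rfl⟩
    · cases e1
    exact .andL (h1 (A0 ::ₘ B0 ::ₘ Γ') (by simp only [← Multiset.singleton_add]; abel)
      ((hc.cast (Multiset.cons_swap _ _ _)).invAnd.cast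
        (by simp only [← Multiset.singleton_add]; abel)))
  | orR₁ _ h1 => intro Γ e h; exact .orR₁ (h1 Γ e h)
  | orR₂ _ h1 => intro Γ e h; exact .orR₂ (h1 Γ e h)
  | @orL Γ0 A0 B0 C0 h h' h1 h2 =>
    intro Γ e hc
    rcases Multiset.cons_eq_cons.1 e with ⟨e1, e2⟩ | ⟨-, Γ', rfl, rfl⟩
    · cases e1
    have hc' := hc.cast (Multiset.cons_swap _ _ _)
    exact .orL (h1 (A0 ::ₘ Γ') (Multiset.cons_swap _ _ _)
      (hc'.invOr₁.cast (Multiset.cons_swap _ _ _))) (h2 (B0 ::ₘ Γ') (Multiset.cons_swap _ _ _)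
      (hc'.invOr₂.cast (Multiset.cons_swap _ _ _)))
  | @impR Γ0 A0 B0 h h1 =>
    intro Γ e hc
    subst e
    exact .impR (h1 (A0 ::ₘ Γ) (Multiset.cons_swap _ _ _)
      ((hc.weak1 A0).cast (Multiset.cons_swap _ _ _)))
  | @impL Γ0 A0 B0 C0 h h' h1 h2 =>
    intro Γ e hc
    rcases Multiset.cons_eq_cons.1 e with ⟨e1, e2⟩ | ⟨-, Γ', rfl, rfl⟩
    · cases e1
      subst e2
      exact hY _ _ (hX _ _ (h1 _ rfl hc) hc) h'
    have hc' := hc.cast (Multiset.cons_swap _ _ _)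
    exact .impL (h1 (A0.imp B0 ::ₘ Γ') (Multiset.cons_swap _ _ _) hc)
      (h2 (B0 ::ₘ Γ') (Multiset.cons_swap _ _ _) (hc'.invImp.cast (Multiset.cons_swap _ _ _)))

theorem PD.cut (A : Pos) : ∀ Γ C, PD Γ A → PD (A ::ₘ Γ) C → PD Γ C := by
  induction A with
  | atm b n => intro Γ C h h'; exact h.cutAt rfl C h'
  | and X Y hX hY =>
    intro Γ C h h'
    obtain ⟨h1, h2⟩ := h.invAndR rfl
    exact hY _ _ h2 (hX _ _ (h1.weak1 Y) h'.invAnd)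
  | or X Y hX hY => intro Γ C h h'; exact h.cutOr hX hY rfl C h'
  | imp X Y hX hY => intro Γ C h h'; exact h'.cutImp hX hY _ rfl (h.invImpR rfl)

theorem PD.id (A : Pos) : ∀ Γ, PD (A ::ₘ Γ) A := by
  induction A with
  | atm b n => intro Γ; exact .ax
  | and X Y hX hY =>
    intro Γ; exact .andL (.andR (hX _) ((hY (X ::ₘ Γ)).cast (Multiset.cons_swap _ _ _)))
  | or X Y hX hY => intro Γ; exact .orL (.orR₁ (hX _)) (.orR₂ (hY _))
  | imp X Y hX hY =>
    intro Γ
    refine .impR ?_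
    rw [Multiset.cons_swap]
    exact .impL ((hX (X.imp Y ::ₘ Γ)).cast (Multiset.cons_swap _ _ _)) (hY _)

theorem PD.idm {A : Pos} {Γ : Multiset Pos} (h : A ∈ Γ) : PD Γ A := by
  obtain ⟨t, rfl⟩ := Multiset.exists_cons_of_mem h
  exact PD.id A t

theorem PD.mcut {Δ : Multiset Pos} {C : Pos} (h : PD Δ C) {Γ : Multiset Pos}
    (hΔ : ∀ x ∈ Δ, PD Γ x) : PD Γ C := by
  have h1 : PD (Δ + Γ) C := (h.weak Γ).cast (add_comm _ _)
  clear h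
  induction Δ using Multiset.induction with
  | empty => simpa using h1
  | cons a Δ ih =>
    refine ih (fun x hx => hΔ x (by simp [hx])) ?_
    refine PD.cut a _ _ ((hΔ a (by simp)).weak Δ) (h1.cast (by simp))

theorem PD.mono {Δ : Multiset Pos} {C : Pos} (h : PD Δ C) {Γ : Multiset Pos}
    (hΔ : Δ ⊆ Γ) : PD Γ C := h.mcut fun _ hx => PD.idm (hΔ hx)

/-! ### Negation normal forms -/

def nnf : Bool → PFormula → Pos
  | b, .var n => .atm b n
  | b, .snot A => nnf (!b) A
  | true, .and A B => .and (nnf true A) (nnf true B)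
  | false, .and A B => .or (nnf false A) (nnf false B)
  | true, .or A B => .or (nnf true A) (nnf true B)
  | false, .or A B => .and (nnf false A) (nnf false B)
  | true, .imp A B => .imp (nnf true A) (nnf true B)
  | false, .imp A B => .imp (nnf true A) (nnf false B)

theorem Gder.toPD {Γ : Multiset PFormula} {A : PFormula} (h : Gder Γ A) :
    PD (Γ.map (nnf true)) (nnf true A) := by
  induction h with
  | ax => simpa [nnf] using PD.ax
  | axSnot => simpa [nnf] using PD.ax
  | andR _ _ h1 h2 => exact .andR h1 h2
  | andL _ h1 => simp [nnf] at *; exact .andL h1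
  | orR₁ _ h1 => exact .orR₁ h1
  | orR₂ _ h1 => exact .orR₂ h1
  | orL _ _ h1 h2 => simp [nnf] at *; exact .orL h1 h2
  | impR _ h1 => simp [nnf] at *; exact .impR h1
  | impL _ _ h1 h2 => simp [nnf] at *; exact .impL h1 h2
  | snotSnotR _ h1 => simpa [nnf] using h1
  | snotSnotL _ h1 => simpa [nnf] using h1
  | snotAndR₁ _ h1 => simp [nnf] at *; exact .orR₁ h1
  | snotAndR₂ _ h1 => simp [nnf] at *; exact .orR₂ h1
  | snotAndL _ _ h1 h2 => simp [nnf] at *; exact .orL h1 h2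
  | snotOrR _ _ h1 h2 => simp [nnf] at *; exact .andR h1 h2
  | snotOrL _ h1 => simp [nnf] at *; exact .andL h1
  | snotImpR _ h1 => simp [nnf] at *; exact .impR h1
  | snotImpL _ _ h1 h2 => simp [nnf] at *; exact .impL h1 h2

/-- Formulas not starting with a double negation. -/
inductive Core : PFormula → Prop
  | var (n) : Core (.var n)
  | nvar (n) : Core (.snot (.var n))
  | and (A B) : Core (.and A B)
  | nand (A B) : Core (.snot (.and A B))
  | or (A B) : Core (.or A B)
  | nor (A B) : Core (.snot (.or A B))
  | imp (A B) : Core (.imp A B)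
  | nimp (A B) : Core (.snot (.imp A B))

theorem peel : ∀ A : PFormula, ∃ A', Core A' ∧ nnf true A' = nnf true A ∧
    (∀ Γ, Gder Γ A' → Gder Γ A) ∧ (∀ Γ C, Gder (A' ::ₘ Γ) C → Gder (A ::ₘ Γ) C)
  | .var n => ⟨_, .var n, rfl, fun _ h => h, fun _ _ h => h⟩
  | .and A B => ⟨_, .and A B, rfl, fun _ h => h, fun _ _ h => h⟩
  | .or A B => ⟨_, .or A B, rfl, fun _ h => h, fun _ _ h => h⟩
  | .imp A B => ⟨_, .imp A B, rfl, fun _ h => h, fun _ _ h => h⟩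
  | .snot (.var n) => ⟨_, .nvar n, rfl, fun _ h => h, fun _ _ h => h⟩
  | .snot (.and A B) => ⟨_, .nand A B, rfl, fun _ h => h, fun _ _ h => h⟩
  | .snot (.or A B) => ⟨_, .nor A B, rfl, fun _ h => h, fun _ _ h => h⟩
  | .snot (.imp A B) => ⟨_, .nimp A B, rfl, fun _ h => h, fun _ _ h => h⟩
  | .snot (.snot A) => by
    obtain ⟨A', h1, h2, h3, h4⟩ := peel A
    exact ⟨A', h1, by simpa [nnf] using h2, fun Γ h => .snotSnotR (h3 Γ h),
      fun Γ C h => .snotSnotL (h4 Γ C h)⟩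

theorem PD.toGder {Θ : Multiset Pos} {X : Pos} (h : PD Θ X) :
    ∀ (Γ : Multiset PFormula) (A : PFormula), Γ.map (nnf true) = Θ → nnf true A = X →
      Gder Γ A := by
  classical
  induction h with
  | ax =>
    intro Γ A e1 e2
    obtain ⟨B, hB, e3, -⟩ := (Multiset.map_eq_cons _ _ _ _).2 e1
    obtain ⟨Γ', rfl⟩ := Multiset.exists_cons_of_mem hB
    obtain ⟨A', hA, eA, rA, -⟩ := peel A
    obtain ⟨B', hB, eB, -, lB⟩ := peel B
    apply rA; apply lB
    rw [e2] at eA; rw [e3] at eB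
    cases hA <;> simp [nnf] at eA <;> cases hB <;> simp [nnf] at eB
    · obtain ⟨rfl, rfl⟩ := eA
      obtain rfl := eB.2
      exact .ax
    · have h1 := eA.1; have h2 := eB.1; simp_all
    · have h1 := eA.1; have h2 := eB.1; simp_all
    · obtain ⟨rfl, rfl⟩ := eA
      obtain rfl := eB.2
      exact .axSnot
  | andR _ _ h1 h2 =>
    intro Γ A e1 e2
    obtain ⟨A', hA, eA, rA, -⟩ := peel A
    apply rA
    rw [e2] at eA
    cases hA <;> simp [nnf] at eA
    · exact .andR (h1 _ _ e1 eA.1) (h2 _ _ e1 eA.2)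
    · exact .snotOrR (h1 _ _ e1 eA.1) (h2 _ _ e1 eA.2)
  | andL _ h1 =>
    intro Γ A e1 e2
    obtain ⟨B, hB, e3, e4⟩ := (Multiset.map_eq_cons _ _ _ _).2 e1
    obtain ⟨Γ', rfl⟩ := Multiset.exists_cons_of_mem hB
    obtain ⟨B', hB, eB, -, lB⟩ := peel B
    apply lB
    rw [e3] at eB
    simp at e4
    cases hB <;> simp [nnf] at eB
    · exact .andL (h1 _ _ (by simp [eB, e4]) e2)
    · exact .snotOrL (h1 _ _ (by simp [nnf, eB, e4]) e2)
  | orR₁ _ h1 =>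
    intro Γ A e1 e2
    obtain ⟨A', hA, eA, rA, -⟩ := peel A
    apply rA
    rw [e2] at eA
    cases hA <;> simp [nnf] at eA
    · exact .snotAndR₁ (h1 _ _ e1 eA.1)
    · exact .orR₁ (h1 _ _ e1 eA.1)
  | orR₂ _ h1 =>
    intro Γ A e1 e2
    obtain ⟨A', hA, eA, rA, -⟩ := peel A
    apply rA
    rw [e2] at eA
    cases hA <;> simp [nnf] at eA
    · exact .snotAndR₂ (h1 _ _ e1 eA.2)
    · exact .orR₂ (h1 _ _ e1 eA.2)
  | orL _ _ h1 h2 =>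
    intro Γ A e1 e2
    obtain ⟨B, hB, e3, e4⟩ := (Multiset.map_eq_cons _ _ _ _).2 e1
    obtain ⟨Γ', rfl⟩ := Multiset.exists_cons_of_mem hB
    obtain ⟨B', hB, eB, -, lB⟩ := peel B
    apply lB
    rw [e3] at eB
    simp at e4
    cases hB <;> simp [nnf] at eB
    · exact .snotAndL (h1 _ _ (by simp [nnf, eB, e4]) e2) (h2 _ _ (by simp [nnf, eB, e4]) e2)
    · exact .orL (h1 _ _ (by simp [eB, e4]) e2) (h2 _ _ (by simp [eB, e4]) e2)
  | impR _ h1 =>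
    intro Γ A e1 e2
    obtain ⟨A', hA, eA, rA, -⟩ := peel A
    apply rA
    rw [e2] at eA
    cases hA <;> simp [nnf] at eA
    · exact .impR (h1 _ _ (by simp [e1, eA.1]) eA.2)
    · exact .snotImpR (h1 _ _ (by simp [e1, eA.1]) eA.2)
  | impL _ _ h1 h2 =>
    intro Γ A e1 e2
    obtain ⟨B, hB, e3, e4⟩ := (Multiset.map_eq_cons _ _ _ _).2 e1
    obtain ⟨Γ', rfl⟩ := Multiset.exists_cons_of_mem hB
    obtain ⟨B', hB, eB, -, lB⟩ := peel B
    apply lB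
    rw [e3] at eB
    simp at e4
    cases hB <;> simp [nnf] at eB
    · exact .impL (h1 _ _ (by simp [nnf, eB, e4]) eB.1) (h2 _ _ (by simp [eB, e4]) e2)
    · exact .snotImpL (h1 _ _ (by simp [nnf, eB, e4]) eB.1) (h2 _ _ (by simp [nnf, eB, e4]) e2)

/-! ### Big conjunctions and disjunctions in the positive calculus -/

theorem PD.andE₁ {Γ : Multiset Pos} {A B : Pos} (h : PD Γ (.and A B)) : PD Γ A := (h.invAndR rfl).1
theorem PD.andE₂ {Γ : Multiset Pos} {A B : Pos} (h : PD Γ (.and A B)) : PD Γ B := (h.invAndR rfl).2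
theorem PD.impE {Γ : Multiset Pos} {A B : Pos} (h : PD Γ (.imp A B)) (h' : PD Γ A) : PD Γ B :=
  PD.cut A _ _ h' (h.invImpR rfl)

theorem PD.foldlAnd {Γ : Multiset Pos} : ∀ (l : List Pos) (a : Pos),
    PD Γ (l.foldl .and a) ↔ PD Γ a ∧ ∀ x ∈ l, PD Γ x
  | [], a => by simp
  | b :: l, a => by
    rw [List.foldl_cons, PD.foldlAnd l]
    simp only [List.mem_cons, forall_eq_or_imp]
    constructor
    · rintro ⟨h1, h2⟩; exact ⟨h1.andE₁, h1.andE₂, h2⟩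
    · rintro ⟨h1, h2, h3⟩; exact ⟨.andR h1 h2, h3⟩

theorem PD.conj {Γ : Multiset Pos} {j : Pos} : ∀ {l : List Pos}, l ≠ [] →
    (PD Γ (foldOfList j .and l) ↔ ∀ x ∈ l, PD Γ x)
  | [], h => absurd rfl h
  | a :: l, _ => by simp [foldOfList, PD.foldlAnd]

theorem PD.foldlOrR {Γ : Multiset Pos} : ∀ (l : List Pos) (a : Pos),
    (PD Γ a ∨ ∃ x ∈ l, PD Γ x) → PD Γ (l.foldl .or a)
  | [], a => by simp
  | b :: l, a => by
    rw [List.foldl_cons]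
    intro h
    apply PD.foldlOrR l
    rcases h with h | ⟨x, hx, h⟩
    · exact .inl (.orR₁ h)
    · rcases List.mem_cons.1 hx with rfl | hx
      · exact .inl (.orR₂ h)
      · exact .inr ⟨x, hx, h⟩

theorem PD.foldlOrL {Γ : Multiset Pos} {C : Pos} : ∀ (l : List Pos) (a : Pos),
    PD (a ::ₘ Γ) C → (∀ x ∈ l, PD (x ::ₘ Γ) C) → PD (l.foldl .or a ::ₘ Γ) C
  | [], a => by simp
  | b :: l, a => by
    intro h h'
    rw [List.foldl_cons]
    exact PD.foldlOrL l _ (.orL h (h' b (by simp))) fun x hx => h' x (by simp [hx])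

theorem PD.disjR {Γ : Multiset Pos} {j x : Pos} : ∀ {l : List Pos}, x ∈ l → PD Γ x →
    PD Γ (foldOfList j .or l)
  | [], h, _ => by simp at h
  | a :: l, h, h' => by
    refine PD.foldlOrR l a ?_
    rcases List.mem_cons.1 h with rfl | hx
    · exact .inl h'
    · exact .inr ⟨x, hx, h'⟩

theorem PD.disjL {Γ : Multiset Pos} {j C : Pos} : ∀ {l : List Pos}, l ≠ [] →
    (∀ x ∈ l, PD (x ::ₘ Γ) C) → PD (foldOfList j .or l ::ₘ Γ) C
  | [], h, _ => absurd rfl h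
  | a :: l, _, h' => PD.foldlOrL l a (h' a (by simp)) fun x hx => h' x (by simp [hx])

theorem choice_distrib {α : Type} : ∀ (n : ℕ) (s : Fin n → ℕ) (x : (i : Fin n) → Fin (s i) → α)
    (o : Fin n → α) (M : List α → Prop)
    (_ : ∀ L R i, (∀ k, M (L ++ x i k :: R)) → M (L ++ o i :: R))
    (_ : ∀ c : (i : Fin n) → Fin (s i), M (List.ofFn fun i => x i (c i))), M (List.ofFn o)
  | 0, s, x, o, M, hM, h => by simpa using h (fun i => i.elim0)
  | n + 1, s, x, o, M, hM, h => by
    rw [List.ofFn_succ]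
    refine hM [] _ 0 fun k => ?_
    refine choice_distrib n (fun i => s i.succ) (fun i k => x i.succ k) _
      (fun l => M ([] ++ x 0 k :: l)) (fun L R i hk => hM (x 0 k :: L) R i.succ hk) fun c => ?_
    have := h (Fin.cons k c)
    rw [List.ofFn_succ] at this
    simpa using this

/-! ### Translation of R-expressions -/

def impf : List Pos → Pos → Pos
  | [], y => y
  | a :: l, y => .imp (l.foldl .and a) y

theorem PD.impf {Γ : Multiset Pos} {y : Pos} : ∀ {l : List Pos},
    PD Γ (impf l y) ↔ PD ((l : Multiset Pos) + Γ) y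
  | [] => by simp [_root_.impf]
  | a :: l => by
    constructor
    · intro h
      refine (h.weak ((a :: l : List Pos) : Multiset Pos)).impE ?_
      rw [PD.foldlAnd]
      exact ⟨PD.idm (by simp), fun x hx => PD.idm (by simp [hx])⟩
    · intro h
      refine .impR (h.mcut fun x hx => ?_)
      have h1 := (PD.foldlAnd l a).1 (PD.id (l.foldl Pos.and a) Γ)
      simp at hx
      rcases hx with (rfl | hx) | hx
      · exact h1.1
      · exact h1.2 x hx
      · exact PD.idm (by simp [hx])

section
variable {K : Type} {ar : K → ℕ} (D : (k : K) → ConnDef (ar k))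

def tr (b : Bool) (S : RExprOf (GFormula K ar)) : Pos := nnf b (starR D S)

theorem barListOf_map {Φ : Type} (sn : Φ → Φ) (an im : Φ → Φ → Φ) (l : List (RExprOf Φ)) :
    barListOf sn an im l = l.map (barOf sn an im) := by
  induction l with
  | nil => simp [barListOf]
  | cons a l ih => simp [barListOf, ih]

theorem star_foldl (l : List (GFormula K ar)) : ∀ a,
    star D (l.foldl .and a) = (l.map (star D)).foldl .and (star D a) := by
  induction l with
  | nil => simp
  | cons b l ih => intro a; simp [ih, _root_.star]

theorem nnf_foldl_and (l : List PFormula) : ∀ a,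
    nnf true (l.foldl .and a) = (l.map (nnf true)).foldl .and (nnf true a) := by
  induction l with
  | nil => simp
  | cons b l ih => intro a; simp [ih, nnf]
theorem nnf_foldl_and' (l : List PFormula) : ∀ a,
    nnf false (l.foldl .and a) = (l.map (nnf false)).foldl .or (nnf false a) := by
  induction l with
  | nil => simp
  | cons b l ih => intro a; simp [ih, nnf]
theorem nnf_foldl_or (l : List PFormula) : ∀ a,
    nnf true (l.foldl .or a) = (l.map (nnf true)).foldl .or (nnf true a) := by
  induction l with
  | nil => simp
  | cons b l ih => intro a; simp [ih, nnf]
theorem nnf_foldl_or' (l : List PFormula) : ∀ a,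
    nnf false (l.foldl .or a) = (l.map (nnf false)).foldl .and (nnf false a) := by
  induction l with
  | nil => simp
  | cons b l ih => intro a; simp [ih, nnf]

theorem nnf_fold_and (l : List PFormula) : nnf true (foldOfList (.var 0) .and l) =
    foldOfList (.atm true 0) .and (l.map (nnf true)) := by
  cases l <;> simp [foldOfList, nnf, nnf_foldl_and]
theorem nnf_fold_and' (l : List PFormula) : nnf false (foldOfList (.var 0) .and l) =
    foldOfList (.atm false 0) .or (l.map (nnf false)) := by
  cases l <;> simp [foldOfList, nnf, nnf_foldl_and']
theorem nnf_fold_or (l : List PFormula) : nnf true (foldOfList (.var 0) .or l) =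
    foldOfList (.atm true 0) .or (l.map (nnf true)) := by
  cases l <;> simp [foldOfList, nnf, nnf_foldl_or]
theorem nnf_fold_or' (l : List PFormula) : nnf false (foldOfList (.var 0) .or l) =
    foldOfList (.atm false 0) .and (l.map (nnf false)) := by
  cases l <;> simp [foldOfList, nnf, nnf_foldl_or']

theorem tr_fm (b : Bool) (A : GFormula K ar) : tr D b (.fm A) = nnf b (star D A) := by
  simp [tr, starR, barG, barOf]
theorem tr_negFm (b : Bool) (A : GFormula K ar) : tr D b (.negFm A) = nnf (!b) (star D A) := by
  simp [tr, starR, barG, barOf, _root_.star, nnf]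

theorem nnf_imp (b : Bool) (A B : PFormula) : nnf b (.imp A B) = .imp (nnf true A) (nnf b B) := by
  cases b <;> rfl

theorem tr_seq (b : Bool) (Δ : List (RExprOf (GFormula K ar))) (S : RExprOf (GFormula K ar)) :
    tr D b (.seq Δ S) = impf (Δ.map (tr D true)) (tr D b S) := by
  cases Δ with
  | nil => simp [tr, starR, barG, barOf, impf]
  | cons U Δ =>
    simp [tr, starR, barG, barOf, impf, _root_.star, nnf_imp, barListOf_map, star_foldl, nnf_foldl_and]
    congr 1

theorem tr_negSeq (b : Bool) (Δ : List (RExprOf (GFormula K ar))) (S : RExprOf (GFormula K ar)) :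
    tr D b (.negSeq Δ S) = impf (Δ.map (tr D true)) (tr D (!b) S) := by
  rw [← tr_seq]
  cases Δ with
  | nil => simp [tr, starR, barG, barOf, _root_.star, nnf]
  | cons U Δ => simp [tr, starR, barG, barOf, _root_.star, nnf]

theorem tr_rneg (b : Bool) (S : RExprOf (GFormula K ar)) :
    tr D b (rnegOf S) = tr D (!b) S := by
  cases S <;> simp [rnegOf, tr_fm, tr_negFm, tr_seq, tr_negSeq]

mutual
theorem starR_inst {m : ℕ} (σ : Fin m → GFormula K ar) : ∀ S : SRExpr m,
    starR D (instOf σ S) = barP (instOf (fun i => star D (σ i)) S)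
  | .fm i => by simp [starR, barG, barP, instOf, barOf]
  | .negFm i => by simp [starR, barG, barP, instOf, barOf, _root_.star]
  | .seq [] S => by
    have h := starR_inst σ S
    simpa [starR, barG, barP, instOf, barOf, _root_.star, instListOf] using h
  | .seq (U :: Γ) S => by
    have h := starR_inst σ S
    have h1 := starR_inst σ U
    have h2 := starR_instList σ Γ
    simp only [starR, barG, barP] at h h1 h2
    simp [starR, barG, barP, instOf, barOf, _root_.star, instListOf, barListOf_map, star_foldl, h, h1,
      ← h2]
    congr 1
  | .negSeq [] S => by
    have h := starR_inst σ S
    simpa [starR, barG, barP, instOf, barOf, _root_.star, instListOf] using h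
  | .negSeq (U :: Γ) S => by
    have h := starR_inst σ S
    have h1 := starR_inst σ U
    have h2 := starR_instList σ Γ
    simp only [starR, barG, barP] at h h1 h2
    simp [starR, barG, barP, instOf, barOf, _root_.star, instListOf, barListOf_map, star_foldl, h, h1,
      ← h2]
    congr 1
theorem starR_instList {m : ℕ} (σ : Fin m → GFormula K ar) : ∀ Δ : List (SRExpr m),
    (instListOf σ Δ).map (starR D) = (instListOf (fun i => star D (σ i)) Δ).map barP
  | [] => by simp [instListOf]
  | U :: Γ => by
    have h1 := starR_inst σ U
    have h2 := starR_instList σ Γ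
    simp [instListOf, h1, h2]
end

theorem tr_app (k : K) (σ : Fin (ar k) → GFormula K ar) :
    nnf true (star D (.app k σ)) = foldOfList (.atm true 0) .or (List.ofFn fun i : Fin (D k).t =>
      foldOfList (.atm true 0) .and (List.ofFn fun j => tr D true (instOf σ ((D k).S i j)))) := by
  simp only [_root_.star, defFormulaP, nnf_fold_or, List.map_ofFn]
  congr 2
  funext i
  simp only [Function.comp, nnf_fold_and, List.map_ofFn, tr, starR_inst]
  rfl

theorem tr_app' (k : K) (σ : Fin (ar k) → GFormula K ar) :
    nnf false (star D (.app k σ)) = foldOfList (.atm false 0) .and (List.ofFn fun i : Fin (D k).t =>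
      foldOfList (.atm false 0) .or (List.ofFn fun j => tr D false (instOf σ ((D k).S i j)))) := by
  simp only [_root_.star, defFormulaP, nnf_fold_or', List.map_ofFn]
  congr 2
  funext i
  simp only [Function.comp, nnf_fold_and', List.map_ofFn, tr, starR_inst]
  rfl

end
set_option linter.unusedSimpArgs false

/-! ### Soundness of SC∞ -/

theorem snoc1 {α : Type} (l : List α) (x : α) : ((l ++ [x] : List α) : Multiset α) = x ::ₘ ↑l := by
  rw [← Multiset.coe_add, add_comm]; rfl
theorem snoc2 {α : Type} (l : List α) (x y : α) :
    ((l ++ [x, y] : List α) : Multiset α) = x ::ₘ y ::ₘ ↑l := by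
  rw [← Multiset.coe_add, add_comm]; rfl

section
variable {K : Type} {ar : K → ℕ} (D : (k : K) → ConnDef (ar k))

theorem semSeq (Δ : List (RExprOf (GFormula K ar))) (S : RExprOf (GFormula K ar)) :
    PD 0 (tr D true (.seq Δ S)) ↔ PD ↑(Δ.map (tr D true)) (tr D true S) := by
  rw [tr_seq, PD.impf, add_zero]

theorem SCG.sound (ht : ∀ k, 0 < (D k).t) (hs : ∀ (k : K) (i : Fin (D k).t), 0 < (D k).s i)
    {R : RExprOf (GFormula K ar)} (h : SCG D ∅ R) : PD 0 (tr D true R) := by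
  induction h with
  | prem h => exact absurd h (by simp)
  | rf S => rw [semSeq]; exact PD.idm (by simp)
  | wl T _ h => rw [semSeq] at *; exact h.mono (by intro x; simp only [Multiset.mem_coe, Multiset.mem_add, Multiset.mem_cons,
      List.map_append, List.mem_append, List.map_cons, List.map_nil, List.mem_cons]; tauto)
  | pl Δ S T Γ _ h =>
    rw [semSeq] at *; exact h.mono (by intro x; simp only [Multiset.mem_coe, Multiset.mem_add, Multiset.mem_cons,
      List.map_append, List.mem_append, List.map_cons, List.map_nil, List.mem_cons]; tauto)
  | cl _ h => rw [semSeq] at *; exact h.mono (by intro x; simp)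
  | cut _ _ h1 h2 =>
    rw [semSeq] at *
    rw [List.map_append, List.map_singleton, snoc1] at h2
    exact PD.cut _ _ _ h1 h2
  | riP _ h =>
    rw [semSeq] at *
    rw [tr_seq, PD.impf]
    exact h.mono (by intro x; simp only [Multiset.mem_coe, Multiset.mem_add, Multiset.mem_cons,
      List.map_append, List.mem_append, List.map_cons, List.map_nil, List.mem_cons]; tauto)
  | @liP Γ Δ S T _ _ h1 h2 =>
    rw [semSeq] at *
    rw [List.map_append, List.map_singleton, snoc1] at *
    refine PD.cut _ _ _ ?_ (h2.mono (Γ := tr D true S ::ₘ _) (by intro x; simp only [Multiset.mem_coe, Multiset.mem_add, Multiset.mem_cons,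
      List.map_append, List.mem_append, List.map_cons, List.map_nil, List.mem_cons]; tauto))
    have h3 := PD.id (tr D true (.seq Δ S)) ↑(List.map (tr D true) Γ)
    rw [tr_seq, PD.impf] at h3
    rw [tr_seq]
    refine h3.mcut fun x hx => ?_
    rw [Multiset.mem_add] at hx
    rcases hx with hx | hx
    · simp at hx
      obtain ⟨U, hU, rfl⟩ := hx
      have := h1 U hU
      rw [semSeq] at this
      exact this.weak1 _
    · exact PD.idm hx
  | riN _ h =>
    rw [semSeq] at *
    rw [tr_rneg] at *
    rw [tr_seq, PD.impf]
    exact h.mono (by intro x; simp only [Multiset.mem_coe, Multiset.mem_add, Multiset.mem_cons,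
      List.map_append, List.mem_append, List.map_cons, List.map_nil, List.mem_cons]; tauto)
  | riN' _ h =>
    rw [semSeq] at *
    rw [tr_rneg] at *
    rw [tr_seq, PD.impf] at h
    exact h.mono (by intro x; simp only [Multiset.mem_coe, Multiset.mem_add, Multiset.mem_cons,
      List.map_append, List.mem_append, List.map_cons, List.map_nil, List.mem_cons]; tauto)
  | @liN Γ Δ S T _ _ h1 h2 =>
    rw [semSeq] at *
    rw [List.map_append, List.map_singleton, snoc1] at *
    rw [tr_rneg] at *
    refine PD.cut _ _ _ ?_ (h2.mono (Γ := tr D false S ::ₘ _) (by intro x; simp only [Multiset.mem_coe, Multiset.mem_add, Multiset.mem_cons,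
      List.map_append, List.mem_append, List.map_cons, List.map_nil, List.mem_cons]; tauto))
    have h3 := PD.id (tr D false (.seq Δ S)) ↑(List.map (tr D true) Γ)
    rw [tr_seq, PD.impf] at h3
    rw [tr_seq]
    refine h3.mcut fun x hx => ?_
    rw [Multiset.mem_add] at hx
    rcases hx with hx | hx
    · simp at hx
      obtain ⟨U, hU, rfl⟩ := hx
      have := h1 U hU
      rw [semSeq] at this
      exact this.weak1 _
    · exact PD.idm hx
  | snotL _ h => rw [semSeq] at *; simpa [tr_fm, tr_negFm, _root_.star, nnf] using h
  | snotR _ h => rw [semSeq] at *; simpa [tr_fm, tr_negFm, _root_.star, nnf] using h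
  | snotLm _ h => rw [semSeq] at *; simpa [tr_fm, tr_negFm, _root_.star, nnf] using h
  | snotRm _ h => rw [semSeq] at *; simpa [tr_fm, tr_negFm, _root_.star, nnf] using h
  | andL _ h =>
    rw [semSeq] at *
    simp only [List.map_append, List.map_cons, List.map_nil, snoc1, snoc2, tr_fm, _root_.star, nnf]
      at *
    exact .andL h
  | andR _ _ h1 h2 =>
    rw [semSeq] at *; simp only [tr_fm, _root_.star, nnf] at *; exact .andR h1 h2
  | andLm _ _ h1 h2 =>
    rw [semSeq] at *
    simp only [List.map_append, List.map_cons, List.map_nil, snoc1, snoc2, tr_negFm, _root_.star,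
      nnf, Bool.not_true] at *
    exact .orL h1 h2
  | andRm₁ _ h1 =>
    rw [semSeq] at *; simp only [tr_negFm, _root_.star, nnf, Bool.not_true] at *; exact .orR₁ h1
  | andRm₂ _ h1 =>
    rw [semSeq] at *; simp only [tr_negFm, _root_.star, nnf, Bool.not_true] at *; exact .orR₂ h1
  | orL _ _ h1 h2 =>
    rw [semSeq] at *
    simp only [List.map_append, List.map_cons, List.map_nil, snoc1, snoc2, tr_fm, _root_.star,
      nnf] at *
    exact .orL h1 h2
  | orR₁ _ h1 =>
    rw [semSeq] at *; simp only [tr_fm, _root_.star, nnf] at *; exact .orR₁ h1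
  | orR₂ _ h1 =>
    rw [semSeq] at *; simp only [tr_fm, _root_.star, nnf] at *; exact .orR₂ h1
  | orLm _ h =>
    rw [semSeq] at *
    simp only [List.map_append, List.map_cons, List.map_nil, snoc1, snoc2, tr_negFm, _root_.star,
      nnf, Bool.not_true] at *
    exact .andL h
  | orRm _ _ h1 h2 =>
    rw [semSeq] at *; simp only [tr_negFm, _root_.star, nnf, Bool.not_true] at *; exact .andR h1 h2
  | impL _ h => rw [semSeq] at *; simpa [tr_fm, tr_seq, impf, _root_.star, nnf] using h
  | impR _ h => rw [semSeq] at *; simpa [tr_fm, tr_seq, impf, _root_.star, nnf] using h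
  | impLm _ h =>
    rw [semSeq] at *; simpa [tr_fm, tr_negFm, tr_negSeq, impf, _root_.star, nnf] using h
  | impRm _ h =>
    rw [semSeq] at *; simpa [tr_fm, tr_negFm, tr_negSeq, impf, _root_.star, nnf] using h
  | @schemaI Δ k σ i _ h =>
    rw [semSeq, tr_fm, tr_app]
    refine PD.disjR (List.mem_ofFn.2 ⟨i, rfl⟩) ?_
    rw [PD.conj (by simp [List.ofFn_eq_nil_iff, (hs k i).ne'])]
    intro x hx
    obtain ⟨j, rfl⟩ := List.mem_ofFn.1 hx
    have := h j
    rwa [semSeq] at this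
  | @schemaII Δ T k σ _ h =>
    rw [semSeq, List.map_append, List.map_singleton, snoc1, tr_fm, tr_app]
    refine PD.disjL (by simp [List.ofFn_eq_nil_iff, (ht k).ne']) fun x hx => ?_
    obtain ⟨i, rfl⟩ := List.mem_ofFn.1 hx
    have h1 := h i
    rw [semSeq] at h1
    refine h1.mcut fun y hy => ?_
    rw [List.map_append, List.map_ofFn, Multiset.mem_coe, List.mem_append] at hy
    rcases hy with hy | hy
    · exact PD.idm (by rw [Multiset.mem_cons]; exact .inr hy)
    · refine (PD.conj (by simp [List.ofFn_eq_nil_iff, (hs k i).ne'])).1 (PD.id _ _) y hy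
  | @schemaIII Δ k σ c _ h =>
    rw [semSeq, tr_negFm, Bool.not_true, tr_app']
    rw [PD.conj (by simp [List.ofFn_eq_nil_iff, (ht k).ne'])]
    intro x hx
    obtain ⟨i, rfl⟩ := List.mem_ofFn.1 hx
    have := h i
    rw [semSeq, tr_rneg] at this
    exact PD.disjR (List.mem_ofFn.2 ⟨c i, rfl⟩) this
  | @schemaIV Δ T k σ _ h =>
    rw [semSeq, List.map_append, List.map_singleton, snoc1, tr_negFm, Bool.not_true, tr_app']
    have key := choice_distrib (D k).t (D k).s
      (fun i j => tr D false (instOf σ ((D k).S i j)))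
      (fun i => foldOfList (.atm false 0) .or
        (List.ofFn fun j => tr D false (instOf σ ((D k).S i j))))
      (fun l => PD (↑l + ↑(Δ.map (tr D true))) (tr D true T)) ?_ ?_
    · refine key.mcut fun x hx => ?_
      rw [Multiset.mem_add] at hx
      rcases hx with hx | hx
      · exact (PD.conj (by simp [List.ofFn_eq_nil_iff, (ht k).ne'])).1 (PD.id _ _) x hx
      · exact PD.idm (by rw [Multiset.mem_cons]; exact .inr hx)
    · intro L R i hk
      refine (PD.disjL (Γ := ↑L + ↑R + ↑(Δ.map (tr D true))) (j := .atm false 0)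
        (l := List.ofFn fun j => tr D false (instOf σ ((D k).S i j)))
        (by simp [List.ofFn_eq_nil_iff, (hs k i).ne']) ?_).mono ?_
      · intro x hx
        obtain ⟨j, rfl⟩ := List.mem_ofFn.1 hx
        exact (hk j).mono (by intro x; simp only [Multiset.mem_add, Multiset.mem_cons,
          Multiset.mem_coe, List.mem_append, List.mem_cons]; tauto)
      · intro x; simp only [Multiset.mem_add, Multiset.mem_cons,
          Multiset.mem_coe, List.mem_append, List.mem_cons]; tauto
    · intro c
      have h1 := h c
      rw [semSeq, List.map_append, List.map_ofFn, ← Multiset.coe_add, add_comm] at h1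
      have e : (tr D true ∘ fun i => rnegOf (instOf σ ((D k).S i (c i)))) =
        fun i => tr D false (instOf σ ((D k).S i (c i))) := by
        funext i; simp [tr_rneg]
      rwa [e] at h1

end

/-! ### Derived rules of SC∞ -/

section
variable {K : Type} {ar : K → ℕ} {D : (k : K) → ConnDef (ar k)}

theorem SCG.perm {P : Set (RExprOf (GFormula K ar))} {X : RExprOf (GFormula K ar)}
    {Γ Γ' : List (RExprOf (GFormula K ar))}
    (p : Γ.Perm Γ') : ∀ L, SCG D P (.seq (L ++ Γ) X) → SCG D P (.seq (L ++ Γ') X) := by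
  induction p with
  | nil => exact fun _ h => h
  | cons x _ ih => intro L h; simpa using ih (L ++ [x]) (by simpa using h)
  | swap x y l => intro L h; exact .pl _ _ _ _ h
  | trans _ _ h1 h2 => exact fun L h => h2 L (h1 L h)

theorem SCG.perm' {P : Set (RExprOf (GFormula K ar))} {X : RExprOf (GFormula K ar)}
    {Γ Γ' : List (RExprOf (GFormula K ar))}
    (h : SCG D P (.seq Γ X)) (p : Γ.Perm Γ') : SCG D P (.seq Γ' X) := SCG.perm p [] h

theorem SCG.wks {P : Set (RExprOf (GFormula K ar))} {X : RExprOf (GFormula K ar)}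
    {Γ : List (RExprOf (GFormula K ar))} (h : SCG D P (.seq Γ X)) (Δ) :
    SCG D P (.seq (Γ ++ Δ) X) := by
  induction Δ generalizing Γ with
  | nil => simpa using h
  | cons a Δ ih => simpa using ih (h.wl a)

theorem SCG.mcut {P : Set (RExprOf (GFormula K ar))} {X : RExprOf (GFormula K ar)}
    {Γ Δ : List (RExprOf (GFormula K ar))} (h : SCG D P (.seq Δ X))
    (hΔ : ∀ U ∈ Δ, SCG D P (.seq Γ U)) : SCG D P (.seq Γ X) := by
  have h1 : SCG D P (.seq (Γ ++ Δ) X) := (h.wks Γ).perm' List.perm_append_comm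
  clear h
  induction Δ with
  | nil => simpa using h1
  | cons a Δ ih =>
    refine ih (fun x hx => hΔ x (by simp [hx])) ?_
    refine SCG.cut ((hΔ a (by simp)).wks Δ) (h1.perm' ?_)
    rw [List.append_assoc]
    exact List.Perm.append_left _ (List.perm_append_singleton a Δ).symm

theorem SCG.idm {P : Set (RExprOf (GFormula K ar))} {X : RExprOf (GFormula K ar)}
    {Γ : List (RExprOf (GFormula K ar))} (h : X ∈ Γ) : SCG D P (.seq Γ X) := by
  obtain ⟨l, r, rfl⟩ := List.append_of_mem h
  exact ((SCG.rf X).wks (l ++ r)).perm' (by simpa using List.perm_middle.symm)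

theorem SCG.mono {P : Set (RExprOf (GFormula K ar))} {X : RExprOf (GFormula K ar)}
    {Γ Δ : List (RExprOf (GFormula K ar))} (h : SCG D P (.seq Δ X)) (hs : Δ ⊆ Γ) :
    SCG D P (.seq Γ X) := h.mcut fun _ hU => SCG.idm (hs hU)

/-- apply a one-premise entailment -/
theorem SCG.ap {P : Set (RExprOf (GFormula K ar))} {X Y : RExprOf (GFormula K ar)}
    {Γ : List (RExprOf (GFormula K ar))} (h : SCG D P (.seq Γ X)) (e : SCG D P (.seq [X] Y)) :
    SCG D P (.seq Γ Y) := e.mcut fun U hU => by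
  rw [List.mem_singleton] at hU; subst hU; exact h

theorem SCG.detach {P : Set (RExprOf (GFormula K ar))} {X : RExprOf (GFormula K ar)}
    {Γ Δ : List (RExprOf (GFormula K ar))} (h : SCG D P (.seq Γ (.seq Δ X)))
    (hΔ : ∀ U ∈ Δ, SCG D P (.seq Γ U)) : SCG D P (.seq Γ X) :=
  SCG.cut h (SCG.liP hΔ (SCG.idm (by simp)))

theorem SCG.unseq {P : Set (RExprOf (GFormula K ar))} {X : RExprOf (GFormula K ar)}
    {Γ Δ : List (RExprOf (GFormula K ar))} (h : SCG D P (.seq Γ (.seq Δ X))) :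
    SCG D P (.seq (Γ ++ Δ) X) :=
  (h.wks Δ).detach fun U hU => SCG.idm (by simp [hU])

/-- Interderivability -/
def Eqv (D : (k : K) → ConnDef (ar k)) (X Y : RExprOf (GFormula K ar)) : Prop :=
  SCG D ∅ (.seq [X] Y) ∧ SCG D ∅ (.seq [Y] X)

theorem Eqv.refl (X : RExprOf (GFormula K ar)) : Eqv D X X := ⟨.rf X, .rf X⟩
theorem Eqv.symm {X Y : RExprOf (GFormula K ar)} (h : Eqv D X Y) : Eqv D Y X := ⟨h.2, h.1⟩
theorem Eqv.trans {X Y Z : RExprOf (GFormula K ar)} (h : Eqv D X Y) (h' : Eqv D Y Z) :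
    Eqv D X Z := ⟨h.1.ap h'.1, h'.2.ap h.2⟩

theorem eqv_snot (A : GFormula K ar) : Eqv D (.fm (.snot A)) (.negFm A) :=
  ⟨SCG.snotL (Δ := []) (.rf _), SCG.snotR (.rf _)⟩
theorem eqv_nsnot (A : GFormula K ar) : Eqv D (.negFm (.snot A)) (.fm A) :=
  ⟨SCG.snotLm (Δ := []) (.rf _), SCG.snotRm (.rf _)⟩
theorem eqv_imp (A B : GFormula K ar) : Eqv D (.fm (.imp A B)) (.seq [.fm A] (.fm B)) :=
  ⟨SCG.impL (Δ := []) (.rf _), SCG.impR (.rf _)⟩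
theorem eqv_nimp (A B : GFormula K ar) : Eqv D (.negFm (.imp A B)) (.negSeq [.fm A] (.fm B)) :=
  ⟨SCG.impLm (Δ := []) (.rf _), SCG.impRm (.rf _)⟩

theorem eqv_negSeq (Γ : List (RExprOf (GFormula K ar))) (X : RExprOf (GFormula K ar)) :
    Eqv D (.negSeq Γ X) (.seq Γ (rnegOf X)) :=
  ⟨SCG.riP (SCG.riN' (SCG.rf _)), SCG.riN (S := X) (SCG.unseq (.rf _))⟩

theorem eqv_and {A B A' B' : GFormula K ar}
    (hA : Eqv D (.fm A) (.fm A')) (hB : Eqv D (.fm B) (.fm B')) :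
    Eqv D (.fm (.and A B)) (.fm (.and A' B')) := by
  have key : ∀ {A B A' B' : GFormula K ar}, SCG D ∅ (.seq [.fm A] (.fm A')) →
      SCG D ∅ (.seq [.fm B] (.fm B')) → SCG D ∅ (.seq [.fm (.and A B)] (.fm (.and A' B'))) := by
    intro A B A' B' h1 h2
    exact SCG.andL (Δ := []) (SCG.andR (h1.mono (by simp)) (h2.mono (by simp)))
  exact ⟨key hA.1 hB.1, key hA.2 hB.2⟩

theorem eqv_or {A B A' B' : GFormula K ar}
    (hA : Eqv D (.fm A) (.fm A')) (hB : Eqv D (.fm B) (.fm B')) :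
    Eqv D (.fm (.or A B)) (.fm (.or A' B')) := by
  have key : ∀ {A B A' B' : GFormula K ar}, SCG D ∅ (.seq [.fm A] (.fm A')) →
      SCG D ∅ (.seq [.fm B] (.fm B')) → SCG D ∅ (.seq [.fm (.or A B)] (.fm (.or A' B'))) := by
    intro A B A' B' h1 h2
    exact SCG.orL (Δ := []) (SCG.orR₁ h1) (SCG.orR₂ h2)
  exact ⟨key hA.1 hB.1, key hA.2 hB.2⟩

theorem eqv_nor {A B A' B' : GFormula K ar}
    (hA : Eqv D (.negFm A) (.fm A')) (hB : Eqv D (.negFm B) (.fm B')) :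
    Eqv D (.negFm (.or A B)) (.fm (.and A' B')) :=
  ⟨SCG.orLm (Δ := []) (SCG.andR (hA.1.mono (by simp)) (hB.1.mono (by simp))),
    SCG.andL (Δ := []) (SCG.orRm (hA.2.mono (by simp)) (hB.2.mono (by simp)))⟩

theorem eqv_nand {A B A' B' : GFormula K ar}
    (hA : Eqv D (.negFm A) (.fm A')) (hB : Eqv D (.negFm B) (.fm B')) :
    Eqv D (.negFm (.and A B)) (.fm (.or A' B')) :=
  ⟨SCG.andLm (Δ := []) (SCG.orR₁ hA.1) (SCG.orR₂ hB.1),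
    SCG.orL (Δ := []) (SCG.andRm₁ hA.2) (SCG.andRm₂ hB.2)⟩

theorem eqv_seq1 {X Y X' Y' : RExprOf (GFormula K ar)} (hA : Eqv D X X') (hB : Eqv D Y Y') :
    Eqv D (.seq [X] Y) (.seq [X'] Y') := by
  have key : ∀ {A B A' B' : RExprOf (GFormula K ar)}, SCG D ∅ (.seq [A'] A) →
      SCG D ∅ (.seq [B] B') → SCG D ∅ (.seq [.seq [A] B] (.seq [A'] B')) := by
    intro A B A' B' h1 h2
    refine SCG.riP (SCG.ap (X := B) (SCG.detach (Δ := [A]) (SCG.idm (by simp)) ?_) h2)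
    intro U hU
    rw [List.mem_singleton] at hU
    subst hU
    exact h1.mono (by simp)
  exact ⟨key hA.2 hB.1, key hA.1 hB.2⟩

/-! ### Embedding the positive calculus -/

def emb : Pos → GFormula K ar
  | .atm true n => .var n
  | .atm false n => .snot (.var n)
  | .and A B => .and (emb A) (emb B)
  | .or A B => .or (emb A) (emb B)
  | .imp A B => .imp (emb A) (emb B)

/-- embedding as an R-expression -/
def emR (X : Pos) : RExprOf (GFormula K ar) := .fm (emb X)

theorem SCG.orL' {Γ : List (RExprOf (GFormula K ar))} {A B : GFormula K ar}
    {T : RExprOf (GFormula K ar)} (h1 : SCG D ∅ (.seq (.fm A :: Γ) T))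
    (h2 : SCG D ∅ (.seq (.fm B :: Γ) T)) : SCG D ∅ (.seq (.fm (.or A B) :: Γ) T) :=
  (SCG.orL (Δ := Γ) (h1.perm' (List.perm_append_singleton _ _).symm)
    (h2.perm' (List.perm_append_singleton _ _).symm)).perm' (List.perm_append_singleton _ _)

theorem PD.toSCG {Θ : Multiset Pos} {X : Pos} (h : PD Θ X) :
    ∀ L : List Pos, Θ ⊆ ↑L → SCG D ∅ (.seq (L.map emR) (emR X)) := by
  induction h with
  | @ax Γ b n =>
    intro L hL
    exact SCG.idm (List.mem_map_of_mem (by simpa using hL (Multiset.mem_cons_self _ _)))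
  | andR _ _ h1 h2 => intro L hL; exact .andR (h1 L hL) (h2 L hL)
  | @andL Γ A B C _ h1 =>
    intro L hL
    have hL' := Multiset.cons_subset.1 hL
    have h0 : SCG D ∅ (.seq (L.map emR) (emR (.and A B))) :=
      SCG.idm (List.mem_map_of_mem (by simpa using hL'.1))
    have := h1 (A :: B :: L) (by
      rw [← Multiset.cons_coe, ← Multiset.cons_coe]
      exact Multiset.cons_subset_cons (Multiset.cons_subset_cons hL'.2))
    refine this.mcut ?_
    intro U hU
    simp only [List.map_cons, List.mem_cons] at hU
    rcases hU with rfl | rfl | hU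
    · exact h0.ap (SCG.andL (Δ := []) (SCG.idm (by simp [emR])))
    · exact h0.ap (SCG.andL (Δ := []) (SCG.idm (by simp [emR])))
    · exact SCG.idm hU
  | orR₁ _ h1 => intro L hL; exact .orR₁ (h1 L hL)
  | orR₂ _ h1 => intro L hL; exact .orR₂ (h1 L hL)
  | @orL Γ A B C _ _ h1 h2 =>
    intro L hL
    have hL' := Multiset.cons_subset.1 hL
    have a1 := h1 (A :: L) (by rw [← Multiset.cons_coe]; exact Multiset.cons_subset_cons hL'.2)
    have a2 := h2 (B :: L) (by rw [← Multiset.cons_coe]; exact Multiset.cons_subset_cons hL'.2)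
    refine (SCG.orL' a1 a2).mono ?_
    refine List.cons_subset.2 ⟨?_, fun _ h => h⟩
    exact List.mem_map_of_mem (f := emR) (a := .or A B) (by simpa using hL'.1)
  | @impR Γ A B _ h1 =>
    intro L hL
    have a1 := h1 (A :: L) (by rw [← Multiset.cons_coe]; exact Multiset.cons_subset_cons hL)
    exact .impR (.riP (a1.perm' (List.perm_append_singleton _ _).symm))
  | @impL Γ A B C _ _ h1 h2 =>
    intro L hL
    have hL' := Multiset.cons_subset.1 hL
    have a1 := h1 L hL
    have a2 := h2 (B :: L) (by rw [← Multiset.cons_coe]; exact Multiset.cons_subset_cons hL'.2)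
    have h0 : SCG D ∅ (.seq (L.map emR) (emR (.imp A B))) :=
      SCG.idm (List.mem_map_of_mem (by simpa using hL'.1))
    refine a2.mcut ?_
    intro U hU
    simp only [List.map_cons, List.mem_cons] at hU
    rcases hU with rfl | hU
    · refine (h0.ap (eqv_imp _ _).1).detach ?_
      intro U hU
      rw [List.mem_singleton] at hU
      subst hU
      exact a1
    · exact SCG.idm hU

theorem PD.toSCG' {L : List Pos} {X : Pos} (h : PD ↑L X) :
    SCG D ∅ (.seq (L.map emR) (emR X)) := h.toSCG L (fun _ h => h)

theorem PD.toSCG1 {X Y : Pos} (h : PD (X ::ₘ 0) Y) :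
    SCG D ∅ (.seq [emR X] (emR Y)) := h.toSCG [X] (by simp)

theorem SCG.foldlOrL {Γ : List (RExprOf (GFormula K ar))} {T : RExprOf (GFormula K ar)} :
    ∀ (l : List Pos) (a : Pos), SCG D ∅ (.seq (emR a :: Γ) T) →
    (∀ x ∈ l, SCG D ∅ (.seq (emR x :: Γ) T)) → SCG D ∅ (.seq (emR (l.foldl .or a) :: Γ) T)
  | [], a => by simp
  | b :: l, a => by
    intro h h'
    rw [List.foldl_cons]
    exact SCG.foldlOrL l _ (SCG.orL' h (h' b (by simp))) fun x hx => h' x (by simp [hx])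

theorem SCG.disjL {Γ : List (RExprOf (GFormula K ar))} {T : RExprOf (GFormula K ar)} {j : Pos} :
    ∀ {l : List Pos}, l ≠ [] → (∀ x ∈ l, SCG D ∅ (.seq (emR x :: Γ) T)) →
    SCG D ∅ (.seq (emR (foldOfList j .or l) :: Γ) T)
  | [], h, _ => absurd rfl h
  | a :: l, _, h' => SCG.foldlOrL l a (h' a (by simp)) fun x hx => h' x (by simp [hx])

/-! ### Completeness -/

theorem eqv_impf {Δ : List (RExprOf (GFormula K ar))} {Y : RExprOf (GFormula K ar)} {y : Pos}
    {f : RExprOf (GFormula K ar) → Pos}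
    (hΔ : ∀ U ∈ Δ, Eqv D U (emR (f U))) (hY : Eqv D Y (emR y)) :
    Eqv D (.seq Δ Y) (emR (impf (Δ.map f) y)) := by
  cases Δ with
  | nil =>
    refine Eqv.trans ⟨SCG.unseq (.rf _), SCG.riP (.rf _)⟩ hY
  | cons U Δ =>
    have e1 : Eqv D (emR (impf ((U :: Δ).map f) y))
      (.seq [emR ((Δ.map f).foldl .and (f U))] (emR y)) := eqv_imp _ _
    refine Eqv.trans ?_ e1.symm
    constructor
    · refine SCG.riP (SCG.ap (X := Y) (SCG.detach (SCG.idm (X := .seq (U :: Δ) Y) (by simp)) ?_)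
        hY.1)
      intro V hV
      refine SCG.ap (X := emR (f V)) ?_ (hΔ V hV).2
      refine SCG.ap (X := emR ((Δ.map f).foldl .and (f U))) (SCG.idm (by simp)) ?_
      apply PD.toSCG1
      have h1 := (PD.foldlAnd _ _).1 (PD.id ((Δ.map f).foldl .and (f U)) 0)
      rcases List.mem_cons.1 hV with rfl | hV
      · exact h1.1
      · exact h1.2 _ (List.mem_map_of_mem hV)
    · refine SCG.riP (SCG.ap (X := emR y) (SCG.detach (SCG.idm (List.mem_append_left _
        (List.mem_singleton_self _))) ?_) hY.2)
      intro V hV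
      rw [List.mem_singleton] at hV
      subst hV
      have h2 : PD ↑((U :: Δ).map f) ((Δ.map f).foldl .and (f U)) :=
        (PD.foldlAnd _ _).2 ⟨PD.idm (by simp), fun x hx => PD.idm (by
          rw [Multiset.mem_coe, List.map_cons]; exact List.mem_cons_of_mem _ hx)⟩
      refine (PD.toSCG' (D := D) h2).mcut ?_
      intro W hW
      rw [List.map_map] at hW
      obtain ⟨V, hV, rfl⟩ := List.mem_map.1 hW
      exact SCG.ap (SCG.idm (List.mem_append_right _ hV)) (hΔ V hV).1

def Good (D : (k : K) → ConnDef (ar k)) (A : GFormula K ar) : Prop :=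
  Eqv D (.fm A) (emR (nnf true (star D A))) ∧ Eqv D (.negFm A) (emR (nnf false (star D A)))

def GoodR (D : (k : K) → ConnDef (ar k)) (S : RExprOf (GFormula K ar)) : Prop :=
  Eqv D S (emR (tr D true S)) ∧ Eqv D (rnegOf S) (emR (tr D false S))

inductive Comp {Φ : Type} (G : Φ → Prop) : RExprOf Φ → Prop
  | fm {A} : G A → Comp G (.fm A)
  | negFm {A} : G A → Comp G (.negFm A)
  | seq {Δ S} : (∀ U ∈ Δ, Comp G U) → Comp G S → Comp G (.seq Δ S)
  | negSeq {Δ S} : (∀ U ∈ Δ, Comp G U) → Comp G S → Comp G (.negSeq Δ S)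

mutual
theorem comp_inst {Φ : Type} {G : Φ → Prop} {m : ℕ} {σ : Fin m → Φ} (h : ∀ i, G (σ i)) :
    ∀ S : SRExpr m, Comp G (instOf σ S)
  | .fm i => by rw [instOf]; exact .fm (h i)
  | .negFm i => by rw [instOf]; exact .negFm (h i)
  | .seq Δ S => by rw [instOf]; exact .seq (comp_instList h Δ) (comp_inst h S)
  | .negSeq Δ S => by rw [instOf]; exact .negSeq (comp_instList h Δ) (comp_inst h S)
theorem comp_instList {Φ : Type} {G : Φ → Prop} {m : ℕ} {σ : Fin m → Φ} (h : ∀ i, G (σ i)) :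
    ∀ Δ : List (SRExpr m), ∀ U ∈ instListOf σ Δ, Comp G U
  | [] => by simp [instListOf]
  | S :: Δ => by
    have h1 := comp_inst h S
    have h2 := comp_instList h Δ
    intro U hU
    rw [instListOf, List.mem_cons] at hU
    rcases hU with rfl | hU
    · exact h1
    · exact h2 U hU
end

mutual
theorem comp_all {Φ : Type} {G : Φ → Prop} (h : ∀ A, G A) : ∀ S : RExprOf Φ, Comp G S
  | .fm i => .fm (h i)
  | .negFm i => .negFm (h i)
  | .seq Δ S => .seq (comp_allList h Δ) (comp_all h S)
  | .negSeq Δ S => .negSeq (comp_allList h Δ) (comp_all h S)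
theorem comp_allList {Φ : Type} {G : Φ → Prop} (h : ∀ A, G A) :
    ∀ Δ : List (RExprOf Φ), ∀ U ∈ Δ, Comp G U
  | [] => by simp
  | S :: Δ => by
    have h1 := comp_all h S
    have h2 := comp_allList h Δ
    intro U hU
    rw [List.mem_cons] at hU
    rcases hU with rfl | hU
    · exact h1
    · exact h2 U hU
end

theorem Comp.good {S : RExprOf (GFormula K ar)} (h : Comp (Good D) S) : GoodR D S := by
  induction h with
  | fm h => simpa [GoodR, Good, tr_fm, rnegOf] using h
  | negFm h => simpa [GoodR, tr_negFm, rnegOf] using And.symm h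
  | seq _ _ h1 h2 =>
    refine ⟨?_, ?_⟩
    · rw [tr_seq]; exact eqv_impf (fun U hU => (h1 U hU).1) h2.1
    · rw [tr_seq]
      exact (eqv_negSeq _ _).trans (eqv_impf (fun U hU => (h1 U hU).1) h2.2)
  | negSeq _ _ h1 h2 =>
    refine ⟨?_, ?_⟩
    · rw [tr_negSeq]
      exact (eqv_negSeq _ _).trans (eqv_impf (fun U hU => (h1 U hU).1) h2.2)
    · rw [tr_negSeq]; exact eqv_impf (fun U hU => (h1 U hU).1) h2.1

theorem good_app (ht : ∀ k, 0 < (D k).t) (hs : ∀ (k : K) (i : Fin (D k).t), 0 < (D k).s i)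
    (k : K) (σ : Fin (ar k) → GFormula K ar) (h : ∀ i, Good D (σ i)) : Good D (.app k σ) := by
  have hg : ∀ i j, GoodR D (instOf σ ((D k).S i j)) := fun i j => (comp_inst h _).good
  have ht' : ∀ {α : Type} (f : Fin (D k).t → α), List.ofFn f ≠ [] := by
    intro α f; simp [List.ofFn_eq_nil_iff, (ht k).ne']
  have hs' : ∀ {α : Type} i (f : Fin ((D k).s i) → α), List.ofFn f ≠ [] := by
    intro α i f; simp [List.ofFn_eq_nil_iff, (hs k i).ne']
  constructor
  · rw [tr_app]
    constructor
    · refine SCG.schemaII (Δ := []) fun i => ?_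
      have h1 : PD ↑(List.ofFn fun j => tr D true (instOf σ ((D k).S i j)))
          (foldOfList (.atm true 0) .or (List.ofFn fun i : Fin (D k).t =>
            foldOfList (.atm true 0) .and
              (List.ofFn fun j => tr D true (instOf σ ((D k).S i j))))) := by
        refine PD.disjR (List.mem_ofFn.2 ⟨i, rfl⟩) ?_
        rw [PD.conj (hs' i _)]
        exact fun x hx => PD.idm hx
      refine (PD.toSCG' (D := D) h1).mcut ?_
      intro U hU
      rw [List.map_ofFn] at hU
      obtain ⟨j, rfl⟩ := List.mem_ofFn.1 hU
      exact SCG.ap (SCG.idm (by rw [List.nil_append]; exact List.mem_ofFn.2 ⟨j, rfl⟩)) (hg i j).1.1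
    · refine SCG.disjL (ht' _) fun x hx => ?_
      obtain ⟨i, rfl⟩ := List.mem_ofFn.1 hx
      refine SCG.schemaI i fun j => ?_
      refine SCG.ap ?_ (hg i j).1.2
      apply PD.toSCG1
      exact (PD.conj (hs' i _)).1 (PD.id _ _) _ (List.mem_ofFn.2 ⟨j, rfl⟩)
  · rw [tr_app']
    constructor
    · refine SCG.schemaIV (Δ := []) fun c => ?_
      have h1 : PD ↑(List.ofFn fun i => tr D false (instOf σ ((D k).S i (c i))))
          (foldOfList (.atm false 0) .and (List.ofFn fun i : Fin (D k).t =>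
            foldOfList (.atm false 0) .or
              (List.ofFn fun j => tr D false (instOf σ ((D k).S i j))))) := by
        rw [PD.conj (ht' _)]
        intro x hx
        obtain ⟨i, rfl⟩ := List.mem_ofFn.1 hx
        exact PD.disjR (List.mem_ofFn.2 ⟨c i, rfl⟩) (PD.idm (List.mem_ofFn.2 ⟨i, rfl⟩))
      refine (PD.toSCG' (D := D) h1).mcut ?_
      intro U hU
      rw [List.map_ofFn] at hU
      obtain ⟨i, rfl⟩ := List.mem_ofFn.1 hU
      exact SCG.ap (SCG.idm (by rw [List.nil_append]; exact List.mem_ofFn.2 ⟨i, rfl⟩))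
        (hg i (c i)).2.1
    · have key := choice_distrib (D k).t (D k).s
        (fun i j => tr D false (instOf σ ((D k).S i j)))
        (fun i => foldOfList (.atm false 0) .or
          (List.ofFn fun j => tr D false (instOf σ ((D k).S i j))))
        (fun l => SCG D ∅ (.seq (l.map emR) (.negFm (.app k σ)))) ?_ ?_
      · refine key.mcut ?_
        intro U hU
        obtain ⟨x, hx, rfl⟩ := List.mem_map.1 hU
        apply PD.toSCG1
        exact (PD.conj (ht' _)).1 (PD.id _ _) x hx
      · intro L R i hk
        have := SCG.disjL (D := D) (Γ := (L ++ R).map emR) (j := .atm false 0)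
          (T := .negFm (.app k σ))
          (l := List.ofFn fun j => tr D false (instOf σ ((D k).S i j))) (hs' i _) ?_
        · refine this.perm' ?_
          exact (List.perm_middle.symm).map emR
        · intro x hx
          obtain ⟨j, rfl⟩ := List.mem_ofFn.1 hx
          exact (hk j).perm' (List.perm_middle.map emR)
      · intro c
        refine SCG.schemaIII c fun i => ?_
        refine SCG.ap (SCG.idm ?_) (hg i (c i)).2.2
        exact List.mem_map_of_mem (List.mem_ofFn.2 ⟨i, rfl⟩)

theorem good_all (ht : ∀ k, 0 < (D k).t) (hs : ∀ (k : K) (i : Fin (D k).t), 0 < (D k).s i)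
    (A : GFormula K ar) : Good D A := by
  induction A with
  | var n => exact ⟨Eqv.refl _, (eqv_snot _).symm⟩
  | snot A h => exact ⟨(eqv_snot _).trans h.2, (eqv_nsnot _).trans h.1⟩
  | and A B hA hB => exact ⟨eqv_and hA.1 hB.1, eqv_nand hA.2 hB.2⟩
  | or A B hA hB => exact ⟨eqv_or hA.1 hB.1, eqv_nor hA.2 hB.2⟩
  | imp A B hA hB =>
    exact ⟨(eqv_imp _ _).trans ((eqv_seq1 hA.1 hB.1).trans (eqv_imp _ _).symm),
      (eqv_nimp _ _).trans ((eqv_negSeq _ _).trans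
        ((eqv_seq1 hA.1 hB.2).trans (eqv_imp _ _).symm))⟩
  | app k σ h => exact good_app ht hs k σ h

end

/-- Lemma 1: an R-expression `Δ ⇒ S` is derivable in `SC∞` extended with the
connectives defined by the schemata (I)–(IV) iff the sequent `Δ* ⇒ S*` is
derivable in `G3C`. -/
theorem lemma_SCinfty_iff_G3C {K : Type} [Fintype K] {ar : K → ℕ}
    (D : (k : K) → ConnDef (ar k))
    (ht : ∀ k, 0 < (D k).t) (hs : ∀ (k : K) (i : Fin (D k).t), 0 < (D k).s i)
    (Δ : List (RExprOf (GFormula K ar))) (S : RExprOf (GFormula K ar)) :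
    SCG D ∅ (.seq Δ S) ↔ Gder (↑(Δ.map (starR D))) (starR D S) := by
  constructor
  · intro h
    have h1 := (semSeq D Δ S).1 (h.sound D ht hs)
    exact h1.toGder _ _ (by simp only [Multiset.map_coe, List.map_map]; rfl) rfl
  · intro h
    have h1 : PD ↑(Δ.map (tr D true)) (tr D true S) :=
      h.toPD.cast (by simp only [Multiset.map_coe, List.map_map]; rfl)
    have hg : ∀ S, GoodR D S := fun S => (comp_all (good_all ht hs) S).good
    refine SCG.ap ((PD.toSCG' (D := D) h1).mcut ?_) (hg S).1.2
    intro U hU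
    rw [List.map_map] at hU
    obtain ⟨V, hV, rfl⟩ := List.mem_map.1 hU
    exact SCG.ap (SCG.idm hV) (hg V).1.1
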